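/- arXiv:math/0107008 — 2 statements merged into one kernel-verified Lean document; each statement's English description precedes it below -/
import Mathlib

section
/- Let X and Y be cocompact generalized Baumslag–Solitar trees with group G, and assume that each tree has a minimal subtree that is not contained in a line. Then: (1) there is an elementary deformation relating X to Y; (2) if X is strongly slide-free, then Y is uniquely reducible to X; and (3) if in addition Y is reduced, then there is a unique isomorphism of G-trees X → Y. -/
universe u

/-- A `G`-tree: a simplicial tree together with an action of `G` by graph
automorphisms without inversions. -/
structure GTree (G : Type u) [Group G] : Type (u + 1) where
  V : Type u
  graph : SimpleGraph V
  isTree : graph.IsTree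
  smul : G → V → V
  smul_one : ∀ x, smul 1 x = x
  smul_mul : ∀ γ δ x, smul (γ * δ) x = smul γ (smul δ x)
  smul_adj : ∀ (γ : G) ⦃x y : V⦄, graph.Adj x y → graph.Adj (smul γ x) (smul γ y)
  no_inversions : ∀ (γ : G) (x y : V), graph.Adj x y → ¬(smul γ x = y ∧ smul γ y = x)

namespace GTree

variable {G : Type u} [Group G]

/-- Oriented edges of a `G`-tree. -/
def Edge (X : GTree G) : Type u := { p : X.V × X.V // X.graph.Adj p.1 p.2 }

/-- Initial vertex `∂₀ e` of an oriented edge. -/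
def d0 {X : GTree G} (e : X.Edge) : X.V := e.1.1

/-- Terminal vertex `∂₁ e` of an oriented edge. -/
def d1 {X : GTree G} (e : X.Edge) : X.V := e.1.2

/-- The underlying geometric (unoriented) edge. -/
def esym {X : GTree G} (e : X.Edge) : Sym2 X.V := s(e.1.1, e.1.2)

/-- Action of `G` on oriented edges. -/
def edgeSmul {X : GTree G} (γ : G) (e : X.Edge) : X.Edge :=
  ⟨(X.smul γ e.1.1, X.smul γ e.1.2), X.smul_adj γ e.2⟩

/-- Vertex stabilizer `G_x`. -/
def stab (X : GTree G) (x : X.V) : Subgroup G where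
  carrier := { γ | X.smul γ x = x }
  one_mem' := X.smul_one x
  mul_mem' := by
    intro a b ha hb
    simp only [Set.mem_setOf_eq] at *
    rw [X.smul_mul, hb, ha]
  inv_mem' := by
    intro a ha
    simp only [Set.mem_setOf_eq] at *
    conv_lhs => rw [← ha]
    rw [← X.smul_mul, inv_mul_cancel, X.smul_one]

/-- Edge stabilizer `G_e`: the elements fixing both endpoints (since the action
is without inversions, these are exactly the elements fixing the edge). -/
def edgeStab (X : GTree G) (e : X.Edge) : Subgroup G :=
  X.stab (d0 e) ⊓ X.stab (d1 e)

/-- An element of `G` is elliptic if it fixes a vertex. -/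
def Elliptic (X : GTree G) (γ : G) : Prop := ∃ x, X.smul γ x = x

/-- A subgroup of `G` is elliptic if it fixes a vertex. -/
def FixesVertex (X : GTree G) (H : Subgroup G) : Prop := ∃ x, ∀ γ ∈ H, X.smul γ x = x

/-- Two `G`-trees have the same elliptic subgroups. -/
def SameEllipticSubgroups (X Y : GTree G) : Prop :=
  ∀ H : Subgroup G, X.FixesVertex H ↔ Y.FixesVertex H

/-- The length function `ℓ_X(γ)`: the minimal vertex displacement. -/
noncomputable def transLen (X : GTree G) (γ : G) : ℕ :=
  sInf (Set.range fun x => X.graph.dist x (X.smul γ x))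

/-- Cocompact: the quotient graph `G\X` is finite, i.e. there are finitely
many orbits of vertices and of edges. -/
def Cocompact (X : GTree G) : Prop :=
  Finite (Quot fun x y : X.V => ∃ γ, X.smul γ x = y) ∧
    Finite (Quot fun e f : X.Edge => ∃ γ, edgeSmul γ e = f)

/-- Reduced: whenever `G_e = G_{∂₀ e}`, the endpoints of `e` are in the same
`G`-orbit. -/
def Reduced (X : GTree G) : Prop :=
  ∀ e : X.Edge, X.edgeStab e = X.stab (d0 e) → ∃ γ, X.smul γ (d0 e) = d1 e

/-- A nonempty `G`-invariant subtree (a nonempty invariant set of vertices that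
is connected in the induced graph). -/
def IsInvariantSubtree (X : GTree G) (S : Set X.V) : Prop :=
  S.Nonempty ∧ (∀ γ, ∀ x ∈ S, X.smul γ x ∈ S) ∧
    ∀ x ∈ S, ∀ y ∈ S, ∃ p : X.graph.Walk x y, ∀ v ∈ p.support, v ∈ S

/-- Minimal: there is no proper nonempty invariant subtree. -/
def Minimal (X : GTree G) : Prop :=
  ∀ S : Set X.V, X.IsInvariantSubtree S → S = Set.univ

/-- Strongly slide-free: minimal, and for all edges `e`, `f` with
`∂₀ e = ∂₀ f`, the inclusion `G_e ⊆ G_f` implies `f ∈ G e`. -/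
def StronglySlideFree (X : GTree G) : Prop :=
  X.Minimal ∧ ∀ e f : X.Edge, d0 e = d0 f → X.edgeStab e ≤ X.edgeStab f →
    ∃ γ, edgeSmul γ e = f

/-- Proper: `G_e ⊊ G_{∂₀ e}` for every edge `e`. -/
def Proper (X : GTree G) : Prop := ∀ e : X.Edge, X.edgeStab e < X.stab (d0 e)

/-- Locally finite: every vertex has finite valence. -/
def LocallyFinite (X : GTree G) : Prop := ∀ x : X.V, (X.graph.neighborSet x).Finite

/-- `φ` is an isomorphism of `G`-trees: an equivariant graph isomorphism. -/
def IsGIso (X Y : GTree G) (φ : X.V → Y.V) : Prop :=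
  Function.Bijective φ ∧ (∀ x y, X.graph.Adj x y ↔ Y.graph.Adj (φ x) (φ y)) ∧
    ∀ γ x, φ (X.smul γ x) = Y.smul γ (φ x)

/-- `φ : X → Y` is the collapse move performed at (the orbit of) the edge `e`:
`G_e = G_{∂₀ e}`, the endpoints of `e` lie in different `G`-orbits, and `Y` is
the equivariant quotient of `X` identifying `∂₀(γ e)` with `∂₁(γ e)` for all
`γ ∈ G`. -/
def IsCollapse (X Y : GTree G) (φ : X.V → Y.V) (e : X.Edge) : Prop :=
  X.edgeStab e = X.stab (d0 e) ∧
  (∀ γ : G, X.smul γ (d0 e) ≠ d1 e) ∧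
  Function.Surjective φ ∧
  (∀ γ x, φ (X.smul γ x) = Y.smul γ (φ x)) ∧
  (∀ u v : X.V, φ u = φ v ↔
    Relation.EqvGen (fun a b => ∃ γ : G, a = X.smul γ (d0 e) ∧ b = X.smul γ (d1 e)) u v) ∧
  (∀ a b : Y.V, a ≠ b → (Y.graph.Adj a b ↔ ∃ u v, X.graph.Adj u v ∧ φ u = a ∧ φ v = b))

/-- `Y` is obtained from `X` by a collapse move. -/
def Collapse (X Y : GTree G) : Prop := ∃ (φ : X.V → Y.V) (e : X.Edge), IsCollapse X Y φ e

/-- Elementary deformation: a finite composition of collapse moves and their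
inverses (expansion moves). -/
def ElemDeformation : GTree G → GTree G → Prop := Relation.EqvGen Collapse

end GTree

namespace GTree

variable {G : Type u} [Group G]

/-- A generalized Baumslag–Solitar tree: a `G`-tree in which all vertex and
edge stabilizers are infinite cyclic. -/
def IsGBSTree (X : GTree G) : Prop :=
  (∀ x : X.V, IsCyclic ↥(X.stab x) ∧ Infinite ↥(X.stab x)) ∧
  (∀ e : X.Edge, IsCyclic ↥(X.edgeStab e) ∧ Infinite ↥(X.edgeStab e))

/-- `X` has a minimal subtree that is not contained in a line: there is a
nonempty invariant subtree `S`, minimal among such, containing a vertex with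
at least three neighbors in `S`. -/
def HasNonlinearMinimalSubtree (X : GTree G) : Prop :=
  ∃ S : Set X.V, X.IsInvariantSubtree S ∧
    (∀ S' ⊆ S, X.IsInvariantSubtree S' → S' = S) ∧
    ∃ v ∈ S, ∃ a ∈ S, ∃ b ∈ S, ∃ c ∈ S,
      a ≠ b ∧ a ≠ c ∧ b ≠ c ∧
      X.graph.Adj v a ∧ X.graph.Adj v b ∧ X.graph.Adj v c

end GTree

namespace SimpleGraph

variable {V : Type*} {T : SimpleGraph V}

/-- A graph is acyclic if every edge is the only one crossed by some two-colouring. -/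
lemma isAcyclic_of_forall_adj_exists_coloring
    (h : ∀ p q, T.Adj p q → ∃ κ : V → ZMod 2, κ p ≠ κ q ∧
      ∀ a b, T.Adj a b → s(a, b) ≠ s(p, q) → κ a = κ b) : T.IsAcyclic := by
  rw [isAcyclic_iff_forall_adj_isBridge]
  intro p q hpq
  obtain ⟨κ, hne, hκ⟩ := h p q hpq
  rw [isBridge_iff]
  rintro ⟨w⟩
  apply hne
  clear hne h hpq
  generalize hS : s(p, q) = S at w hκ
  clear hS
  induction w with
  | nil => rfl
  | cons hadj _ ih =>
    rw [deleteEdges_adj] at hadj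
    exact (hκ _ _ hadj.1 (by simpa using hadj.2)).trans ih

/-- The vertex `v` lies on the geodesic from `a` to `b`. -/
def IsBtw (T : SimpleGraph V) (a v b : V) : Prop := T.dist a v + T.dist v b = T.dist a b

open Classical in
/-- The neighbour of `x` in the direction of `p`, or `x` itself when `x = p`. -/
noncomputable def toward (T : SimpleGraph V) (x p : V) : V :=
  if h : ∃ w, T.Adj x w ∧ T.dist x p = T.dist w p + 1 then h.choose else x

namespace IsTree

lemma dist_triangle (hT : T.IsTree) (a b c : V) : T.dist a c ≤ T.dist a b + T.dist b c :=
  hT.connected.dist_triangle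

lemma dist_eq_zero (hT : T.IsTree) {a b : V} : T.dist a b = 0 ↔ a = b :=
  hT.connected.dist_eq_zero_iff

lemma dist_pos (hT : T.IsTree) {a b : V} (h : a ≠ b) : 0 < T.dist a b :=
  hT.connected.pos_dist_of_ne h

lemma dist_adj (hT : T.IsTree) {u v : V} (p : V) (h : T.Adj u v) :
    T.dist u p = T.dist v p + 1 ∨ T.dist v p = T.dist u p + 1 := by
  rw [T.dist_comm (u := u), T.dist_comm (u := v)]
  exact hT.dist_eq_dist_add_one_of_adj p h

lemma exists_toward (hT : T.IsTree) {x p : V} (h : x ≠ p) :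
    ∃ w, T.Adj x w ∧ T.dist x p = T.dist w p + 1 := by
  obtain ⟨W, hW⟩ := hT.connected.exists_walk_length_eq_dist x p
  cases W with
  | nil => exact absurd rfl h
  | @cons _ w _ hadj W' =>
    refine ⟨w, hadj, ?_⟩
    have h1 := T.dist_le W'
    rw [Walk.length_cons] at hW
    rcases hT.dist_adj p hadj with h2 | h2 <;> omega

lemma eq_of_dist_eq (hT : T.IsTree) {x p w w' : V} (h : T.Adj x w) (h' : T.Adj x w')
    (hd : T.dist x p = T.dist w p + 1) (hd' : T.dist x p = T.dist w' p + 1) : w = w' := by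
  obtain ⟨W, hW⟩ := hT.connected.exists_walk_length_eq_dist w p
  obtain ⟨W', hW'⟩ := hT.connected.exists_walk_length_eq_dist w' p
  have p1 : (Walk.cons h W).IsPath := Walk.isPath_of_length_eq_dist _ (by simp [hW, hd])
  have p2 : (Walk.cons h' W').IsPath := Walk.isPath_of_length_eq_dist _ (by simp [hW', hd'])
  have := (hT.existsUnique_path x p).unique p1 p2
  injection this

lemma toward_spec (hT : T.IsTree) {x p : V} (h : x ≠ p) :
    T.Adj x (T.toward x p) ∧ T.dist x p = T.dist (T.toward x p) p + 1 := by
  have h' := hT.exists_toward h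
  rw [toward, dif_pos h']
  exact h'.choose_spec

lemma eq_toward (hT : T.IsTree) {x p w : V} (h : T.Adj x w)
    (hd : T.dist x p = T.dist w p + 1) : T.toward x p = w := by
  have hne : x ≠ p := by
    rintro rfl
    simp at hd
  obtain ⟨h1, h2⟩ := hT.toward_spec hne
  exact hT.eq_of_dist_eq h1 h h2 hd

lemma toward_self (x : V) : T.toward x x = x := by
  rw [toward, dif_neg]
  simp

lemma dist_of_ne_toward (hT : T.IsTree) {x p w : V} (h : T.Adj x w) (hne : T.toward x p ≠ w) :
    T.dist w p = T.dist x p + 1 := by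
  rcases hT.dist_adj p h with h1 | h1
  · exact absurd (hT.eq_toward h h1) hne
  · exact h1

lemma toward_adj (hT : T.IsTree) {x p : V} (h : T.Adj x p) : T.toward x p = p :=
  hT.eq_toward h (by simp [dist_eq_one_iff_adj.mpr h])

lemma btw_of_toward_ne (hT : T.IsTree) {p x q : V} (h : T.toward x p ≠ T.toward x q) :
    T.IsBtw p x q := by
  obtain ⟨n, hn⟩ : ∃ n, T.dist x q = n := ⟨_, rfl⟩
  induction n generalizing x with
  | zero =>
    obtain rfl := hT.dist_eq_zero.mp hn
    simp [IsBtw]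
  | succ n ih =>
    have hxq : x ≠ q := by
      rintro rfl
      simp at hn
    obtain ⟨h1, h2⟩ := hT.toward_spec hxq
    have h3 := hT.dist_of_ne_toward h1 h
    have h4 : T.toward (T.toward x q) p = x := hT.eq_toward h1.symm h3
    have h5 : T.toward (T.toward x q) q ≠ x := by
      intro h6
      by_cases h7 : T.toward x q = q
      · rw [h7, toward_self] at h6
        exact hxq h6.symm
      · have := (hT.toward_spec h7).2
        rw [h6] at this
        omega
    have h6 : T.IsBtw p (T.toward x q) q := ih (by rw [h4]; exact h5.symm) (by omega)
    have c1 := T.dist_comm (u := p) (v := T.toward x q)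
    have c2 := T.dist_comm (u := p) (v := x)
    unfold IsBtw at *
    omega

lemma toward_ne_of_btw (hT : T.IsTree) {p x q : V} (h : T.IsBtw p x q) (hp : x ≠ p) (hq : x ≠ q) :
    T.toward x p ≠ T.toward x q := by
  intro he
  obtain ⟨h1, h2⟩ := hT.toward_spec hp
  obtain ⟨h3, h4⟩ := hT.toward_spec hq
  have h5 := hT.dist_triangle p (T.toward x p) q
  have c1 := T.dist_comm (u := p) (v := T.toward x p)
  have c2 := T.dist_comm (u := p) (v := x)
  unfold IsBtw at h
  rw [he] at h2 h5 c1
  omega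

lemma btw_iff (hT : T.IsTree) {p x q : V} :
    T.IsBtw p x q ↔ x = p ∨ x = q ∨ T.toward x p ≠ T.toward x q := by
  constructor
  · intro h
    by_cases hp : x = p
    · exact Or.inl hp
    by_cases hq : x = q
    · exact Or.inr (Or.inl hq)
    exact Or.inr (Or.inr (hT.toward_ne_of_btw h hp hq))
  · rintro (rfl | rfl | h)
    · simp [IsBtw]
    · simp [IsBtw]
    · exact hT.btw_of_toward_ne h

lemma toward_eq_of_dist_lt (hT : T.IsTree) {x p q : V} (h : T.dist p q < T.dist x p) :
    T.toward x p = T.toward x q := by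
  by_contra hne
  have := hT.btw_of_toward_ne hne
  unfold IsBtw at this
  rw [T.dist_comm (u := p) (v := x)] at this
  omega

/-- A vertex well inside a geodesic stays on it when the end points are perturbed. -/
lemma btw_of_dist_lt (hT : T.IsTree) {p x q p' q' : V} (h : T.IsBtw p x q)
    (hp : T.dist p p' < T.dist x p) (hq : T.dist q q' < T.dist x q) : T.IsBtw p' x q' := by
  apply hT.btw_of_toward_ne
  rw [← hT.toward_eq_of_dist_lt hp, ← hT.toward_eq_of_dist_lt hq]
  apply hT.toward_ne_of_btw h
  · rintro rfl
    simp at hp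
  · rintro rfl
    simp at hq

/-- Every symmetric function on the edges of a tree is a coboundary modulo two. -/
lemma exists_potential (hT : T.IsTree) (w : V → V → ZMod 2) (hw : ∀ u v, w u v = w v u) :
    ∃ κ : V → ZMod 2, ∀ u v, T.Adj u v → κ u + κ v = w u v := by
  obtain ⟨r⟩ := hT.connected.nonempty
  let K : ℕ → V → ZMod 2 := fun n => Nat.rec (fun _ => 0)
    (fun _ k v => k (T.toward v r) + w v (T.toward v r)) n
  have key : ∀ u v, T.Adj u v → T.dist u r = T.dist v r + 1 →
      K (T.dist u r) u + K (T.dist v r) v = w u v := by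
    intro u v h hd
    rw [hd]
    change K (T.dist v r) (T.toward u r) + w u (T.toward u r) + K (T.dist v r) v = w u v
    rw [hT.eq_toward h hd, add_right_comm, CharTwo.add_self_eq_zero, zero_add]
  refine ⟨fun v => K (T.dist v r) v, fun u v h => ?_⟩
  rcases hT.dist_adj r h with hd | hd
  · exact key u v h hd
  · rw [hw, add_comm]
    exact key v u h.symm hd

/-- Convexity of geodesics. -/
lemma btw_of_btw_of_btw (hT : T.IsTree) {p q u v x : V} (hu : T.IsBtw p u q) (hv : T.IsBtw p v q)
    (hx : T.IsBtw u x v) : T.IsBtw p x q := by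
  by_contra hn
  rw [hT.btw_iff] at hn
  push Not at hn
  obtain ⟨h1, h2, h3⟩ := hn
  have key : ∀ y, T.IsBtw p y q → y ≠ x → T.toward x y = T.toward x p := by
    intro y hy hyx
    by_contra hne
    have b1 := hT.btw_of_toward_ne hne
    have b2 : T.IsBtw y x q := hT.btw_of_toward_ne (by rwa [← h3])
    have t := hT.dist_triangle p x q
    have d := hT.dist_pos hyx
    have d1 := hT.dist_pos h1
    have d2 := (hT.toward_spec h1).2
    have d3 := (hT.toward_spec h2).2
    have t2 := hT.dist_triangle p (T.toward x p) q
    have c1 := T.dist_comm (u := p) (v := y)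
    have c2 := T.dist_comm (u := p) (v := x)
    have c3 := T.dist_comm (u := p) (v := T.toward x p)
    unfold IsBtw at *
    rw [h3] at d2 t2 c3
    omega
  by_cases hux : u = x
  · subst hux; exact (hT.btw_iff.mp hu).elim h1 (fun h => h.elim h2 (fun h => h h3))
  by_cases hvx : v = x
  · subst hvx; exact (hT.btw_iff.mp hv).elim h1 (fun h => h.elim h2 (fun h => h h3))
  exact hT.toward_ne_of_btw hx (Ne.symm hux) (Ne.symm hvx)
    ((key u hu hux).trans (key v hv hvx).symm)

/-- Two vertices are joined by a walk along the geodesic. -/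
lemma exists_walk_btw (hT : T.IsTree) (u v : V) :
    ∃ p : T.Walk u v, ∀ w ∈ p.support, T.IsBtw u w v := by
  obtain ⟨W, hW⟩ := hT.connected.exists_walk_length_eq_dist u v
  refine ⟨W, fun w hw => ?_⟩
  classical
  have h1 := T.dist_le (W.takeUntil w hw)
  have h2 := T.dist_le (W.dropUntil w hw)
  have h3 := congrArg Walk.length (W.take_spec hw)
  rw [Walk.length_append] at h3
  have h4 := hT.dist_triangle u w v
  unfold IsBtw
  omega

lemma btw_toward (hT : T.IsTree) (u v : V) : T.IsBtw u (T.toward u v) v := by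
  by_cases h : u = v
  · subst h; simp [IsBtw, toward_self]
  · obtain ⟨h1, h2⟩ := hT.toward_spec h
    unfold IsBtw
    rw [dist_eq_one_iff_adj.mpr h1]
    omega

end IsTree

end SimpleGraph

lemma SimpleGraph.dist_map_le {V V' : Type*} {T : SimpleGraph V} {T' : SimpleGraph V'}
    (hT : T.Connected) (φ : V → V') (h : ∀ u v, T.Adj u v → T'.Adj (φ u) (φ v)) (a b : V) :
    T'.dist (φ a) (φ b) ≤ T.dist a b := by
  obtain ⟨W, hW⟩ := hT.exists_walk_length_eq_dist a b
  let F : T →g T' := ⟨φ, fun {u v} => h u v⟩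
  have := T'.dist_le (W.map F)
  rw [Walk.length_map, hW] at this
  exact this

namespace GTree

open SimpleGraph

variable {G : Type u} [Group G]

section Basic

variable (X : GTree G)

@[simp] lemma inv_smul_smul (g : G) (x : X.V) : X.smul g⁻¹ (X.smul g x) = x := by
  rw [← X.smul_mul, inv_mul_cancel, X.smul_one]

@[simp] lemma smul_inv_smul (g : G) (x : X.V) : X.smul g (X.smul g⁻¹ x) = x := by
  rw [← X.smul_mul, mul_inv_cancel, X.smul_one]

lemma smul_injective (g : G) : Function.Injective (X.smul g) :=
  Function.LeftInverse.injective (X.inv_smul_smul g)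

lemma smul_eq_iff {g : G} {x y : X.V} : X.smul g x = y ↔ x = X.smul g⁻¹ y := by
  constructor
  · rintro rfl; simp
  · rintro rfl; simp

lemma adj_smul_iff (g : G) {x y : X.V} :
    X.graph.Adj (X.smul g x) (X.smul g y) ↔ X.graph.Adj x y := by
  refine ⟨fun h => ?_, fun h => X.smul_adj g h⟩
  simpa using X.smul_adj g⁻¹ h

@[simp] lemma dist_smul (g : G) (x y : X.V) :
    X.graph.dist (X.smul g x) (X.smul g y) = X.graph.dist x y := by
  apply le_antisymm
  · exact dist_map_le X.isTree.connected _ (fun u v h => X.smul_adj g h) x y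
  · simpa using dist_map_le X.isTree.connected (X.smul g⁻¹) (fun u v h => X.smul_adj g⁻¹ h)
      (X.smul g x) (X.smul g y)

lemma mem_stab {g : G} {x : X.V} : g ∈ X.stab x ↔ X.smul g x = x := Iff.rfl

lemma btw_smul_iff (g : G) (a x b : X.V) :
    X.graph.IsBtw (X.smul g a) (X.smul g x) (X.smul g b) ↔ X.graph.IsBtw a x b := by
  simp [IsBtw]

lemma toward_smul (g : G) (x p : X.V) :
    X.graph.toward (X.smul g x) (X.smul g p) = X.smul g (X.graph.toward x p) := by
  by_cases h : x = p
  · subst h; simp [IsTree.toward_self]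
  · obtain ⟨h1, h2⟩ := X.isTree.toward_spec h
    exact X.isTree.eq_toward (X.smul_adj g h1) (by simpa using h2)

lemma smul_toward_of_mem {g : G} {x p : X.V} (hx : g ∈ X.stab x) (hp : g ∈ X.stab p) :
    g ∈ X.stab (X.graph.toward x p) := by
  rw [mem_stab] at *
  rw [← toward_smul, hx, hp]

/-- An element fixing two vertices fixes the geodesic between them. -/
lemma mem_stab_of_btw {g : G} {a x b : X.V} (ha : g ∈ X.stab a) (hb : g ∈ X.stab b)
    (h : X.graph.IsBtw a x b) : g ∈ X.stab x := by
  obtain ⟨n, hn⟩ : ∃ n, X.graph.dist a x = n := ⟨_, rfl⟩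
  induction n generalizing a with
  | zero => rwa [← X.isTree.dist_eq_zero.mp hn]
  | succ n ih =>
    have hax : a ≠ x := by
      rintro rfl
      simp at hn
    obtain ⟨h1, h2⟩ := X.isTree.toward_spec hax
    have h3 := X.isTree.dist_triangle (X.graph.toward a x) x b
    have h4 := X.isTree.dist_adj b h1
    have h5 : X.graph.dist a b = X.graph.dist (X.graph.toward a x) b + 1 := by
      unfold IsBtw at h
      omega
    refine ih (a := X.graph.toward a x) ?_ ?_ (by omega)
    · rw [X.isTree.eq_of_dist_eq h1 (X.isTree.toward_spec _).1 h5
        (X.isTree.toward_spec (x := a) (p := b) _).2]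
      · exact X.smul_toward_of_mem ha hb
      all_goals
        rintro rfl
        simp at h5
    · unfold IsBtw at *
      omega

lemma mem_stab_smul {g h : G} {x : X.V} : g ∈ X.stab (X.smul h x) ↔ h⁻¹ * g * h ∈ X.stab x := by
  rw [mem_stab, mem_stab, X.smul_mul, X.smul_mul, X.smul_eq_iff (g := h⁻¹), inv_inv]

/-- An element with a fixed vertex does not move a vertex to a neighbour. -/
lemma not_adj_smul_of_fixed {g : G} {p a : X.V} (hp : X.smul g p = p) :
    ¬ X.graph.Adj a (X.smul g a) := by
  intro h
  have h1 := X.dist_smul g a p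
  rw [hp] at h1
  rcases X.isTree.dist_adj p h with h2 | h2 <;> omega

end Basic

/-- A surjective equivariant map sending edges to edges or vertices, such that the vertex
stabilizers of the target are elliptic in the source. -/
structure IsEllMap {X Y : GTree G} (f : X.V → Y.V) : Prop where
  map_smul : ∀ g x, f (X.smul g x) = Y.smul g (f x)
  map_adj : ∀ u v, X.graph.Adj u v → f u = f v ∨ Y.graph.Adj (f u) (f v)
  surj : Function.Surjective f
  ell : ∀ y, X.FixesVertex (Y.stab y)

/-- An `IsEllMap` with connected fibres. -/
structure IsContraction {X Y : GTree G} (f : X.V → Y.V) : Prop extends IsEllMap f where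
  conn : ∀ u v, f u = f v → Relation.EqvGen (fun a b => X.graph.Adj a b ∧ f a = f b) u v

/-- A relation whose classes can be contracted, relative to a map `f`. -/
structure IsContractible {X Y : GTree G} (f : X.V → Y.V) (R : X.V → X.V → Prop) : Prop where
  adj : ∀ u v, R u v → X.graph.Adj u v
  map_eq : ∀ u v, R u v → f u = f v
  smul : ∀ g u v, R u v → R (X.smul g u) (X.smul g v)

section Contract

variable {X Y : GTree G} {f : X.V → Y.V} {R : X.V → X.V → Prop}

/-- The graph obtained from `X` by identifying the vertices related by `R`. -/
def quotGraph (X : GTree G) (R : X.V → X.V → Prop) : SimpleGraph (Quot R) where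
  Adj p q := p ≠ q ∧ ∃ u v, X.graph.Adj u v ∧ Quot.mk R u = p ∧ Quot.mk R v = q
  symm := ⟨by
    rintro p q ⟨h, u, v, h1, h2, h3⟩
    exact ⟨h.symm, v, u, h1.symm, h3, h2⟩⟩
  loopless := ⟨fun p h => h.1 rfl⟩

lemma quotGraph_isTree (hR : ∀ u v, R u v → X.graph.Adj u v) : (quotGraph X R).IsTree := by
  have hconn : (quotGraph X R).Connected := by
    have : Nonempty (Quot R) := X.isTree.connected.nonempty.map (Quot.mk R)
    refine ⟨?_⟩
    rintro ⟨u⟩ ⟨v⟩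
    obtain ⟨W⟩ := X.isTree.connected u v
    induction W with
    | nil => rfl
    | @cons a b c hadj _ ih =>
      refine Reachable.trans ?_ ih
      by_cases h : Quot.mk R a = Quot.mk R b
      · rw [h]
      · exact Adj.reachable ⟨h, a, b, hadj, rfl, rfl⟩
  refine ⟨hconn, isAcyclic_of_forall_adj_exists_coloring ?_⟩
  rintro _ _ ⟨hne, u, v, hadj, rfl, rfl⟩
  classical
  obtain ⟨κ, hκ⟩ := X.isTree.exists_potential
    (fun a b => if s(Quot.mk R a, Quot.mk R b) = s(Quot.mk R u, Quot.mk R v) then 1 else 0)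
    (fun a b => by rw [Sym2.eq_swap])
  have hlift : ∀ a b, R a b → κ a = κ b := by
    intro a b hab
    have := hκ a b (hR a b hab)
    rw [if_neg, CharTwo.add_eq_zero] at this
    · exact this
    · rw [Quot.sound hab]
      intro h
      rw [Sym2.eq_iff] at h
      rcases h with ⟨h1, h2⟩ | ⟨h1, h2⟩
      · exact hne (h1.symm.trans h2)
      · exact hne (h2.symm.trans h1)
  refine ⟨Quot.lift κ hlift, ?_, ?_⟩
  · change κ u ≠ κ v
    intro h
    have := hκ u v hadj
    rw [if_pos rfl, h, CharTwo.add_self_eq_zero] at this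
    exact zero_ne_one this
  · rintro _ _ ⟨-, a, b, hab, rfl, rfl⟩ hS
    change κ a = κ b
    have := hκ a b hab
    rwa [if_neg hS, CharTwo.add_eq_zero] at this

/-- The `G`-tree obtained by contracting the edges in `R`. -/
def contract (hf : IsEllMap f) (hR : IsContractible f R) : GTree G where
  V := Quot R
  graph := quotGraph X R
  isTree := quotGraph_isTree hR.adj
  smul g := Quot.map (X.smul g) (hR.smul g)
  smul_one := by
    rintro ⟨x⟩
    exact congrArg (Quot.mk R) (X.smul_one x)
  smul_mul := by
    rintro g h ⟨x⟩
    exact congrArg (Quot.mk R) (X.smul_mul g h x)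
  smul_adj := by
    rintro g _ _ ⟨hne, u, v, hadj, rfl, rfl⟩
    refine ⟨fun h => hne ?_, _, _, X.smul_adj g hadj, rfl, rfl⟩
    have := congrArg (Quot.map (X.smul g⁻¹) (hR.smul g⁻¹)) h
    simpa [Quot.map] using this
  no_inversions := by
    rintro g _ _ ⟨hne, u, v, hadj, rfl, rfl⟩ ⟨h1, h2⟩
    have e1 : Y.smul g (f u) = f v := by
      rw [← hf.map_smul]
      exact congrArg (Quot.lift f hR.map_eq) h1
    have e2 : Y.smul g (f v) = f u := by
      rw [← hf.map_smul]
      exact congrArg (Quot.lift f hR.map_eq) h2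
    rcases hf.map_adj u v hadj with h | h
    · obtain ⟨p, hp⟩ := hf.ell (f u)
      have hgp : X.smul g p = p := hp g (by rw [mem_stab, e1, h])
      have hT := quotGraph_isTree hR.adj
      have hle : ∀ k : G, ∀ a b, (quotGraph X R).dist (Quot.map (X.smul k) (hR.smul k) a)
          (Quot.map (X.smul k) (hR.smul k) b) ≤ (quotGraph X R).dist a b := by
        intro k
        apply dist_map_le hT.connected
        rintro _ _ ⟨hne, u, v, hadj, rfl, rfl⟩
        refine ⟨fun h => hne ?_, _, _, X.smul_adj k hadj, rfl, rfl⟩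
        have := congrArg (Quot.map (X.smul k⁻¹) (hR.smul k⁻¹)) h
        simpa [Quot.map] using this
      have l1 := hle g (Quot.mk R u) (Quot.mk R p)
      have l2 := hle g (Quot.mk R v) (Quot.mk R p)
      have hp' : Quot.map (X.smul g) (hR.smul g) (Quot.mk R p) = Quot.mk R p :=
        congrArg (Quot.mk R) hgp
      rw [h1, hp'] at l1
      rw [h2, hp'] at l2
      have hadj' : (quotGraph X R).Adj (Quot.mk R u) (Quot.mk R v) := ⟨hne, u, v, hadj, rfl, rfl⟩
      rcases hT.dist_adj (Quot.mk R p) hadj' with h3 | h3 <;> omega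
    · exact Y.no_inversions g _ _ h ⟨e1, e2⟩

lemma contract_mk (hf : IsEllMap f) (hR : IsContractible f R) :
    IsContraction (X := X) (Y := contract hf hR) (Quot.mk R) where
  map_smul _ _ := rfl
  map_adj u v h := by
    by_cases h' : Quot.mk R u = Quot.mk R v
    · exact Or.inl h'
    · exact Or.inr ⟨h', u, v, h, rfl, rfl⟩
  surj := Quot.mk_surjective
  ell := by
    rintro ⟨x⟩
    obtain ⟨p, hp⟩ := hf.ell (f x)
    refine ⟨p, fun g hg => hp g ?_⟩
    rw [mem_stab, ← hf.map_smul]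
    exact congrArg (Quot.lift f hR.map_eq) hg
  conn u v h := by
    refine (Quot.eqvGen_exact h).mono fun a b hab => ?_
    exact ⟨hR.adj a b hab, Quot.sound hab⟩

lemma contract_lift (hf : IsEllMap f) (hR : IsContractible f R) :
    IsEllMap (X := contract hf hR) (Y := Y) (Quot.lift f hR.map_eq) where
  map_smul := by
    rintro g ⟨x⟩
    exact hf.map_smul g x
  map_adj := by
    rintro _ _ ⟨-, u, v, h, rfl, rfl⟩
    exact hf.map_adj u v h
  surj y := by
    obtain ⟨x, rfl⟩ := hf.surj y
    exact ⟨Quot.mk R x, rfl⟩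
  ell y := by
    obtain ⟨p, hp⟩ := hf.ell y
    exact ⟨Quot.mk R p, fun g hg => congrArg (Quot.mk R) (hp g hg)⟩

/-- If `f` has connected fibres, so has the induced map on a contraction of its source. -/
lemma contract_lift_isContraction (hf : IsContraction f) (hR : IsContractible f R) :
    IsContraction (X := contract hf.toIsEllMap hR) (Y := Y) (Quot.lift f hR.map_eq) where
  toIsEllMap := contract_lift hf.toIsEllMap hR
  conn := by
    rintro ⟨u⟩ ⟨v⟩ h
    have := hf.conn u v h
    clear h
    induction this with
    | rel a b h =>
      by_cases h' : Quot.mk R a = Quot.mk R b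
      · rw [h']; exact Relation.EqvGen.refl _
      · exact Relation.EqvGen.rel _ _ ⟨⟨h', a, b, h.1, rfl, rfl⟩, h.2⟩
    | refl => exact Relation.EqvGen.refl _
    | symm _ _ _ ih => exact Relation.EqvGen.symm _ _ ih
    | trans _ _ _ _ _ ih1 ih2 => exact Relation.EqvGen.trans _ _ _ ih1 ih2

end Contract

/-- Data for enlarging the tree `X` by an extra vertex `w` next to `s w` for every `w : W`,
where the edge of `X` from `a` to `b` is reattached at `t a b` and `t b a`. -/
structure BlowUpData (X : GTree G) (W : Type u) where
  act : G → W → W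
  act_one : ∀ w, act 1 w = w
  act_mul : ∀ g h w, act (g * h) w = act g (act h w)
  s : W → X.V
  s_act : ∀ g w, s (act g w) = X.smul g (s w)
  t : X.V → X.V → X.V ⊕ W
  t_smul : ∀ g a b, t (X.smul g a) (X.smul g b) = Sum.map (X.smul g) (act g) (t a b)
  proj_t : ∀ a b, Sum.elim id s (t a b) = a

namespace BlowUpData

variable {X : GTree G} {W : Type u} (D : BlowUpData X W)

/-- The projection of a blow-up to the original tree. -/
def proj : X.V ⊕ W → X.V := Sum.elim id D.s

/-- The graph underlying a blow-up. -/
def graph : SimpleGraph (X.V ⊕ W) where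
  Adj p q := (∃ w, p = Sum.inl (D.s w) ∧ q = Sum.inr w) ∨
    (∃ w, q = Sum.inl (D.s w) ∧ p = Sum.inr w) ∨
    ∃ a b, X.graph.Adj a b ∧ p = D.t a b ∧ q = D.t b a
  symm := ⟨by
    rintro p q (h | h | ⟨a, b, h, h1, h2⟩)
    · exact Or.inr (Or.inl h)
    · exact Or.inl h
    · exact Or.inr (Or.inr ⟨b, a, h.symm, h2, h1⟩)⟩
  loopless := ⟨by
    rintro p (⟨w, h1, h2⟩ | ⟨w, h1, h2⟩ | ⟨a, b, h, h1, h2⟩)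
    · simp [h1] at h2
    · simp [h1] at h2
    · have := congrArg D.proj (h1.symm.trans h2)
      unfold proj at this
      rw [D.proj_t, D.proj_t] at this
      exact h.ne this⟩

lemma adj_inl_inr (w : W) : D.graph.Adj (Sum.inl (D.s w)) (Sum.inr w) := Or.inl ⟨w, rfl, rfl⟩

lemma adj_t {a b : X.V} (h : X.graph.Adj a b) : D.graph.Adj (D.t a b) (D.t b a) :=
  Or.inr (Or.inr ⟨a, b, h, rfl, rfl⟩)

lemma proj_adj {p q : X.V ⊕ W} (h : D.graph.Adj p q) :
    D.proj p = D.proj q ∨ X.graph.Adj (D.proj p) (D.proj q) := by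
  rcases h with (⟨w, rfl, rfl⟩ | ⟨w, rfl, rfl⟩ | ⟨a, b, h, rfl, rfl⟩)
  · exact Or.inl rfl
  · exact Or.inl rfl
  · right
    unfold proj
    rwa [D.proj_t, D.proj_t]

lemma eqvGen_inl (p : X.V ⊕ W) :
    Relation.EqvGen (fun a b => D.graph.Adj a b ∧ D.proj a = D.proj b)
      (Sum.inl (D.proj p)) p := by
  rcases p with a | w
  · exact Relation.EqvGen.refl _
  · exact Relation.EqvGen.rel _ _ ⟨D.adj_inl_inr w, rfl⟩

lemma reachable_inl (p : X.V ⊕ W) : D.graph.Reachable (Sum.inl (D.proj p)) p := by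
  rcases p with a | w
  · exact Reachable.refl _
  · exact (D.adj_inl_inr w).reachable

lemma graph_isTree : D.graph.IsTree := by
  have hpt : ∀ a b, D.proj (D.t a b) = a := D.proj_t
  have hconn : D.graph.Connected := by
    have : Nonempty (X.V ⊕ W) := X.isTree.connected.nonempty.map Sum.inl
    refine ⟨fun p q => ?_⟩
    refine (D.reachable_inl p).symm.trans (Reachable.trans ?_ (D.reachable_inl q))
    generalize D.proj p = x, D.proj q = y
    obtain ⟨P⟩ := X.isTree.connected x y
    induction P with
    | nil => rfl
    | @cons a b c hadj _ ih =>
      refine Reachable.trans ?_ ih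
      have h1 := D.reachable_inl (D.t a b)
      have h2 := D.reachable_inl (D.t b a)
      rw [hpt] at h1 h2
      exact h1.trans ((D.adj_t hadj).reachable.trans h2.symm)
  refine ⟨hconn, isAcyclic_of_forall_adj_exists_coloring ?_⟩
  classical
  have key1 : ∀ w : W, ∃ κ : X.V ⊕ W → ZMod 2, κ (Sum.inl (D.s w)) ≠ κ (Sum.inr w) ∧
      ∀ p q, D.graph.Adj p q → s(p, q) ≠ s(Sum.inl (D.s w), Sum.inr w) → κ p = κ q := by
    intro w
    let δ : X.V ⊕ W → ZMod 2 := fun p => if p = Sum.inr w then 1 else 0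
    obtain ⟨κ, hκ⟩ := X.isTree.exists_potential
      (fun a b => δ (D.t a b) + δ (D.t b a)) (fun a b => add_comm _ _)
    have hedge : ∀ w', s(Sum.inl (D.s w'), Sum.inr w') ≠
        (s(Sum.inl (D.s w), Sum.inr w) : Sym2 (X.V ⊕ W)) → δ (Sum.inr w') = 0 := by
      intro w' h
      apply if_neg
      intro h'
      rw [Sum.inr.injEq] at h'
      exact h (by rw [h'])
    refine ⟨fun p => κ (D.proj p) + δ p, ?_, ?_⟩
    · simp [proj, δ]
    · rintro p q (⟨w', rfl, rfl⟩ | ⟨w', rfl, rfl⟩ | ⟨a, b, h, rfl, rfl⟩) hne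
      · have := hedge w' hne
        simp [proj, δ] at this ⊢
        simp [this]
      · have := hedge w' (by rwa [Sym2.eq_swap])
        simp [proj, δ] at this ⊢
        simp [this]
      · have h1 := hκ a b h
        beta_reduce
        rw [hpt, hpt, ← CharTwo.add_eq_zero]
        calc κ a + δ (D.t a b) + (κ b + δ (D.t b a))
            = (κ a + κ b) + (δ (D.t a b) + δ (D.t b a)) := by ring
          _ = 0 := by rw [h1, CharTwo.add_self_eq_zero]
  rintro p q (⟨w, rfl, rfl⟩ | ⟨w, rfl, rfl⟩ | ⟨a0, b0, h0, rfl, rfl⟩)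
  · exact key1 w
  · obtain ⟨κ, h1, h2⟩ := key1 w
    refine ⟨κ, h1.symm, fun p q h h' => h2 p q h ?_⟩
    rwa [Sym2.eq_swap (a := Sum.inl _)]
  · obtain ⟨κ, hκ⟩ := X.isTree.exists_potential
      (fun a b => if s(a, b) = s(a0, b0) then 1 else 0) (fun a b => by rw [Sym2.eq_swap])
    refine ⟨κ ∘ D.proj, ?_, ?_⟩
    · have := hκ a0 b0 h0
      rw [if_pos rfl] at this
      simp only [Function.comp, hpt]
      intro h
      rw [h, CharTwo.add_self_eq_zero] at this
      exact zero_ne_one this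
    · rintro p q (⟨w, rfl, rfl⟩ | ⟨w, rfl, rfl⟩ | ⟨a, b, h, rfl, rfl⟩) hne
      · rfl
      · rfl
      · have := hκ a b h
        rw [if_neg, CharTwo.add_eq_zero] at this
        · simpa only [Function.comp, hpt] using this
        · intro h'
          rw [Sym2.eq_iff] at h'
          rcases h' with ⟨rfl, rfl⟩ | ⟨rfl, rfl⟩
          · exact hne rfl
          · exact hne Sym2.eq_swap

lemma proj_map (g : G) (p : X.V ⊕ W) :
    D.proj (Sum.map (X.smul g) (D.act g) p) = X.smul g (D.proj p) := by
  rcases p with a | w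
  · rfl
  · exact D.s_act g w

/-- The blow-up of `X` along the given data. -/
def blowUp : GTree G where
  V := X.V ⊕ W
  graph := D.graph
  isTree := D.graph_isTree
  smul g := Sum.map (X.smul g) (D.act g)
  smul_one := by rintro (a | w) <;> simp [X.smul_one, D.act_one]
  smul_mul := by rintro g h (a | w) <;> simp [X.smul_mul, D.act_mul]
  smul_adj := by
    rintro g p q (⟨w, rfl, rfl⟩ | ⟨w, rfl, rfl⟩ | ⟨a, b, h, rfl, rfl⟩)
    · exact Or.inl ⟨D.act g w, by simp [D.s_act], rfl⟩
    · exact Or.inr (Or.inl ⟨D.act g w, by simp [D.s_act], rfl⟩)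
    · exact Or.inr (Or.inr ⟨_, _, X.smul_adj g h, (D.t_smul g a b).symm, (D.t_smul g b a).symm⟩)
  no_inversions := by
    rintro g p q (⟨w, rfl, rfl⟩ | ⟨w, rfl, rfl⟩ | ⟨a, b, h, rfl, rfl⟩) ⟨h1, h2⟩
    · simp at h1
    · simp at h1
    · have e1 := congrArg D.proj h1
      have e2 := congrArg D.proj h2
      rw [proj_map] at e1 e2
      have hpt : ∀ a b, D.proj (D.t a b) = a := D.proj_t
      rw [hpt, hpt] at e1 e2
      exact X.no_inversions g a b h ⟨e1, e2⟩

lemma isContraction_proj : IsContraction (X := D.blowUp) (Y := X) D.proj where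
  map_smul := D.proj_map
  map_adj _ _ h := D.proj_adj h
  surj x := ⟨Sum.inl x, rfl⟩
  ell x := ⟨Sum.inl x, fun _ hg => congrArg Sum.inl hg⟩
  conn u v h := by
    have h1 := D.eqvGen_inl u
    rw [h] at h1
    exact h1.symm.trans _ _ _ (D.eqvGen_inl v)

end BlowUpData

/-- The vertices of `X` fall into finitely many orbits. -/
def VFinite (X : GTree G) : Prop := ∃ K : Set X.V, K.Finite ∧ ∀ x, ∃ g, X.smul g x ∈ K

lemma IsGIso.symm {X Y : GTree G} {φ : X.V → Y.V} (h : IsGIso X Y φ) :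
    ∃ ψ : Y.V → X.V, IsGIso Y X ψ ∧ (∀ x, ψ (φ x) = x) ∧ ∀ y, φ (ψ y) = y := by
  obtain ⟨hb, ha, hs⟩ := h
  let e := Equiv.ofBijective φ hb
  have h1 : ∀ x, e.symm (φ x) = x := e.symm_apply_apply
  have h2 : ∀ y, φ (e.symm y) = y := e.apply_symm_apply
  refine ⟨e.symm, ⟨e.symm.bijective, ?_, ?_⟩, h1, h2⟩
  · intro x y
    rw [ha, h2, h2]
  · intro g y
    apply hb.1
    rw [h2, hs, h2]

lemma IsCollapse.comp_isGIso {B X Y : GTree G} {π : B.V → X.V} {e : B.Edge} {φ : X.V → Y.V}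
    (hπ : IsCollapse B X π e) (hφ : IsGIso X Y φ) : IsCollapse B Y (φ ∘ π) e := by
  obtain ⟨h1, h2, h3, h4, h5, h6⟩ := hπ
  obtain ⟨hb, ha, hs⟩ := hφ
  refine ⟨h1, h2, hb.2.comp h3, ?_, ?_, ?_⟩
  · intro γ x
    simp [h4, hs]
  · intro u v
    rw [← h5]
    exact hb.1.eq_iff
  · intro a b hab
    obtain ⟨a, rfl⟩ := hb.2 a
    obtain ⟨b, rfl⟩ := hb.2 b
    rw [← ha, h6 a b (fun h => hab (congrArg φ h))]
    simp only [Function.comp, hb.1.eq_iff]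

/-- Every `G`-tree is obtained by some collapse. -/
lemma exists_isCollapse (X : GTree G) :
    ∃ (B : GTree G) (π : B.V → X.V) (e : B.Edge), IsCollapse B X π e := by
  obtain ⟨x0⟩ := X.isTree.connected.nonempty
  let W : Type u := { x : X.V // ∃ g, X.smul g x0 = x }
  let D : BlowUpData X W :=
    { act := fun g w => ⟨X.smul g w.1, by
        obtain ⟨h, hh⟩ := w.2
        exact ⟨g * h, by rw [X.smul_mul, hh]⟩⟩
      act_one := fun w => Subtype.ext (X.smul_one _)
      act_mul := fun g h w => Subtype.ext (X.smul_mul _ _ _)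
      s := Subtype.val
      s_act := fun _ _ => rfl
      t := fun a _ => Sum.inl a
      t_smul := fun _ _ _ => rfl
      proj_t := fun _ _ => rfl }
  let w0 : W := ⟨x0, 1, X.smul_one x0⟩
  have hrel : ∀ w : W, Relation.EqvGen (fun a b : D.blowUp.V => ∃ γ : G,
      a = D.blowUp.smul γ (Sum.inr w0) ∧ b = D.blowUp.smul γ (Sum.inl x0))
      (Sum.inr w) (Sum.inl w.1) := by
    rintro ⟨_, γ, rfl⟩
    exact Relation.EqvGen.rel _ _ ⟨γ, rfl, rfl⟩
  have hgen : ∀ p : D.blowUp.V, Relation.EqvGen (fun a b : D.blowUp.V => ∃ γ : G,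
      a = D.blowUp.smul γ (Sum.inr w0) ∧ b = D.blowUp.smul γ (Sum.inl x0))
      p (Sum.inl (D.proj p)) := by
    rintro (a | w)
    · exact Relation.EqvGen.refl _
    · exact hrel w
  refine ⟨D.blowUp, D.proj, ⟨(Sum.inr w0, Sum.inl x0), (D.adj_inl_inr w0).symm⟩, ?_, ?_,
    D.isContraction_proj.surj, D.proj_map, ?_, ?_⟩
  · apply inf_eq_left.mpr
    intro g hg
    exact congrArg (Sum.inl ∘ Subtype.val) (Sum.inr.inj hg)
  · intro γ h
    simp [d0, d1, BlowUpData.blowUp] at h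
  · intro u v
    constructor
    · intro h
      have h1 := hgen u
      rw [h] at h1
      exact h1.trans _ _ _ ((hgen v).symm)
    · intro h
      induction h with
      | rel a b h =>
        obtain ⟨γ, rfl, rfl⟩ := h
        rfl
      | refl => rfl
      | symm _ _ _ ih => exact ih.symm
      | trans _ _ _ _ _ ih1 ih2 => exact ih1.trans ih2
  · intro a b hab
    constructor
    · intro h
      exact ⟨Sum.inl a, Sum.inl b, D.adj_t h, rfl, rfl⟩
    · rintro ⟨u, v, h, rfl, rfl⟩
      exact (D.proj_adj h).resolve_left hab

lemma IsGIso.elemDeformation {X Y : GTree G} {φ : X.V → Y.V} (h : IsGIso X Y φ) :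
    ElemDeformation X Y := by
  obtain ⟨B, π, e, hπ⟩ := X.exists_isCollapse
  exact (Relation.EqvGen.symm _ _ (Relation.EqvGen.rel B X ⟨π, e, hπ⟩)).trans _ _ _
    (Relation.EqvGen.rel B Y ⟨_, e, hπ.comp_isGIso h⟩)

lemma IsEllMap.isGIso {X Y : GTree G} {f : X.V → Y.V} (hf : IsEllMap f)
    (hi : Function.Injective f) : IsGIso X Y f := by
  have hadj : ∀ u v, X.graph.Adj u v → Y.graph.Adj (f u) (f v) := fun u v h =>
    (hf.map_adj u v h).resolve_left fun h' => h.ne (hi h')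
  refine ⟨⟨hi, hf.surj⟩, fun u v => ⟨hadj u v, fun h => ?_⟩, hf.map_smul⟩
  let F : X.graph →g Y.graph := ⟨f, fun {u v} => hadj u v⟩
  obtain ⟨P, hP, -⟩ := X.isTree.existsUnique_path u v
  have h1 : (P.map F).IsPath := Walk.IsPath.map hi hP
  have h2 : (Walk.cons h Walk.nil : Y.graph.Walk (f u) (f v)).IsPath := by
    simp [h.ne]
  have h3 := (Y.isTree.existsUnique_path (f u) (f v)).unique h1 h2
  have h4 := congrArg Walk.length h3
  rw [Walk.length_map] at h4
  exact Walk.adj_of_length_eq_one h4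

/-- The orbit of an edge inside a fibre can be contracted. -/
lemma isContractible_orbit {X Z : GTree G} {f : X.V → Z.V} (hf : IsEllMap f) {a b : X.V}
    (hab : X.graph.Adj a b) (h : f a = f b) :
    IsContractible f (fun u v => ∃ γ : G, u = X.smul γ a ∧ v = X.smul γ b) where
  adj := by
    rintro _ _ ⟨γ, rfl, rfl⟩
    exact X.smul_adj γ hab
  map_eq := by
    rintro _ _ ⟨γ, rfl, rfl⟩
    rw [hf.map_smul, hf.map_smul, h]
  smul := by
    rintro g _ _ ⟨γ, rfl, rfl⟩
    exact ⟨g * γ, by rw [X.smul_mul], by rw [X.smul_mul]⟩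

/-- Inside a fibre of an `IsEllMap`, one of the ends of an edge has the same stabilizer as the
edge, and the ends are in different orbits. -/
lemma exists_collapsible {X Z : GTree G} {f : X.V → Z.V} (hf : IsEllMap f) {u v : X.V}
    (huv : X.graph.Adj u v) (h : f u = f v) :
    ∃ a b, X.graph.Adj a b ∧ f a = f b ∧ X.stab a ≤ X.stab b ∧ ∀ g, X.smul g a ≠ b := by
  obtain ⟨p, hp⟩ := hf.ell (f u)
  have main : ∀ a b, X.graph.Adj a b → f a = f b → f a = f u →
      X.graph.dist a p = X.graph.dist b p + 1 →
      X.stab a ≤ X.stab b ∧ ∀ g, X.smul g a ≠ b := by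
    intro a b hab h1 h2 h3
    have hne : a ≠ p := by
      rintro rfl
      simp at h3
    constructor
    · intro g hg
      have hgp : g ∈ X.stab p := hp g (by rw [← h2, mem_stab, ← hf.map_smul, hg])
      rw [← X.isTree.eq_toward hab h3]
      exact X.smul_toward_of_mem hg hgp
    · rintro g rfl
      have hgp : X.smul g p = p := hp g (by rw [← h2, mem_stab, ← hf.map_smul, ← h1])
      exact X.not_adj_smul_of_fixed hgp hab
  rcases X.isTree.dist_adj p huv with h3 | h3
  · exact ⟨u, v, huv, h, main u v huv h rfl h3⟩
  · exact ⟨v, u, huv.symm, h.symm, main v u huv.symm h.symm h.symm h3⟩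

lemma collapse_contract {X Z : GTree G} {f : X.V → Z.V} (hf : IsEllMap f) {a b : X.V}
    (hab : X.graph.Adj a b) (h : f a = f b) (hst : X.stab a ≤ X.stab b)
    (horb : ∀ g, X.smul g a ≠ b) :
    Collapse X (contract hf (isContractible_orbit hf hab h)) := by
  refine ⟨Quot.mk _, ⟨(a, b), hab⟩, inf_eq_left.mpr hst, horb, Quot.mk_surjective,
    fun _ _ => rfl, fun u v => Quot.eq, ?_⟩
  intro p q hpq
  exact ⟨fun h => h.2, fun h => ⟨hpq, h⟩⟩

/-- An injectivity criterion for maps with connected fibres. -/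
lemma IsContraction.injective {X Z : GTree G} {f : X.V → Z.V} (hf : IsContraction f)
    (h : ∀ u v, X.graph.Adj u v → f u ≠ f v) : Function.Injective f := by
  intro u v huv
  have := hf.conn u v huv
  clear huv
  induction this with
  | rel a b h' => exact absurd h'.2 (h a b h'.1)
  | refl => rfl
  | symm _ _ _ ih => exact ih.symm
  | trans _ _ _ _ _ ih1 ih2 => exact ih1.trans ih2

/-- A contraction of a tree with finitely many vertex orbits is an elementary deformation. -/
lemma IsContraction.elemDeformation {X Z : GTree G} {f : X.V → Z.V} (hf : IsContraction f)
    (hX : VFinite X) : ElemDeformation X Z := by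
  obtain ⟨K, hK, hKX⟩ := hX
  obtain ⟨n, hn⟩ : ∃ n, K.ncard = n := ⟨_, rfl⟩
  induction n using Nat.strong_induction_on generalizing X with
  | _ n ih =>
  by_cases hinj : ∀ u v, X.graph.Adj u v → f u ≠ f v
  · exact (hf.isGIso (hf.injective hinj)).elemDeformation
  push Not at hinj
  obtain ⟨u, v, huv, hfuv⟩ := hinj
  obtain ⟨a, b, hab, hfab, hst, horb⟩ := exists_collapsible hf.toIsEllMap huv hfuv
  have hR := isContractible_orbit hf.toIsEllMap hab hfab
  have hc := collapse_contract hf.toIsEllMap hab hfab hst horb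
  refine (Relation.EqvGen.rel _ _ hc).trans _ _ _ ?_
  obtain ⟨ga, hga⟩ := hKX a
  obtain ⟨gb, hgb⟩ := hKX b
  have hne : X.smul gb b ≠ X.smul ga a := by
    intro h
    apply horb (gb⁻¹ * ga)
    rw [X.smul_mul, ← h, X.inv_smul_smul]
  refine ih _ ?_ (contract_lift_isContraction hf hR) (Quot.mk _ '' (K \ {X.smul ga a}))
    (hK.sdiff.image _) ?_ rfl
  · calc (Quot.mk _ '' (K \ {X.smul ga a})).ncard ≤ (K \ {X.smul ga a}).ncard :=
          Set.ncard_image_le hK.sdiff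
      _ < K.ncard := Set.ncard_sdiff_singleton_lt_of_mem hga hK
      _ = n := hn
  · rintro ⟨x⟩
    obtain ⟨g, hg⟩ := hKX x
    by_cases hx : X.smul g x = X.smul ga a
    · refine ⟨gb * ga⁻¹ * g, X.smul gb b, ⟨hgb, hne⟩, ?_⟩
      have : X.smul (gb * ga⁻¹ * g) x = X.smul gb a := by
        rw [X.smul_mul, hx, X.smul_mul, X.inv_smul_smul]
      refine Eq.trans ?_ (congrArg (Quot.mk _) this.symm)
      exact (Quot.sound ⟨gb, rfl, rfl⟩).symm
    · exact ⟨g, X.smul g x, ⟨hg, hx⟩, rfl⟩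

end GTree

namespace GTree

open SimpleGraph

variable {G : Type u} [Group G] {X Y : GTree G} {f : X.V → Y.V}

/-- A map of trees which is injective on edges and on links is injective. -/
lemma IsEllMap.injective_of_locally_injective (hf : IsEllMap f)
    (hadj : ∀ u v, X.graph.Adj u v → f u ≠ f v)
    (hloc : ∀ a b c, X.graph.Adj a b → X.graph.Adj a c → f b = f c → b = c) :
    Function.Injective f := by
  have key : ∀ n u v, X.graph.dist v u = n → Y.graph.dist (f v) (f u) = n := by
    intro n
    induction n using Nat.strong_induction_on with
    | _ n ih =>
    intro u v hn
    by_cases hvu : v = u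
    · subst hvu
      simp at hn ⊢
      exact hn
    obtain ⟨h1, h2⟩ := X.isTree.toward_spec hvu
    set v1 := X.graph.toward v u
    have d1 := ih _ (by omega) u v1 rfl
    have h1' := (hf.map_adj _ _ h1).resolve_left (hadj _ _ h1)
    by_cases hvu1 : v1 = u
    · have h0 : X.graph.dist v1 u = 0 := X.isTree.dist_eq_zero.mpr hvu1
      rw [hvu1] at h1'
      rw [dist_eq_one_iff_adj.mpr h1']
      omega
    obtain ⟨h3, h4⟩ := X.isTree.toward_spec hvu1
    set v2 := X.graph.toward v1 u
    have d2 := ih _ (by omega) u v2 rfl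
    have h3' := (hf.map_adj _ _ h3).resolve_left (hadj _ _ h3)
    have ht : Y.graph.toward (f v1) (f u) = f v2 := Y.isTree.eq_toward h3' (by omega)
    have hne : f v2 ≠ f v := by
      intro h
      have := hloc _ _ _ h3 h1.symm h
      rw [this] at h4
      omega
    have := Y.isTree.dist_of_ne_toward (p := f u) h1'.symm (by rwa [ht])
    omega
  intro u v h
  have := key _ v u rfl
  rw [h, SimpleGraph.dist_self] at this
  exact X.isTree.dist_eq_zero.mp this.symm

/-- The edges along which a half fold is performed: the orbit of `(a₀, c₀)`. -/
abbrev FoldVertex (a₀ : X.V) (c₀ : Y.V) : Type u :=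
  { w : X.V × Y.V // ∃ g : G, X.smul g a₀ = w.1 ∧ Y.smul g c₀ = w.2 }

open Classical in
/-- The data for splitting off from each translate of `a₀` all its edges mapped to the
corresponding translate of the edge from `f a₀` to `c₀`. -/
noncomputable def foldData (hf : IsEllMap f) (a₀ : X.V) (c₀ : Y.V) :
    BlowUpData X (FoldVertex a₀ c₀) where
  act g w := ⟨(X.smul g w.1.1, Y.smul g w.1.2), by
    obtain ⟨h, h1, h2⟩ := w.2
    exact ⟨g * h, by simp [X.smul_mul, h1], by simp [Y.smul_mul, h2]⟩⟩
  act_one w := Subtype.ext (Prod.ext (X.smul_one _) (Y.smul_one _))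
  act_mul g h w := Subtype.ext (Prod.ext (X.smul_mul _ _ _) (Y.smul_mul _ _ _))
  s w := w.1.1
  s_act _ _ := rfl
  t a b := if h : ∃ g : G, X.smul g a₀ = a ∧ Y.smul g c₀ = f b then
    Sum.inr ⟨(a, f b), h⟩ else Sum.inl a
  t_smul g a b := by
    by_cases h : ∃ k : G, X.smul k a₀ = a ∧ Y.smul k c₀ = f b
    · have h' : ∃ k : G, X.smul k a₀ = X.smul g a ∧ Y.smul k c₀ = f (X.smul g b) := by
        obtain ⟨k, h1, h2⟩ := h
        exact ⟨g * k, by rw [X.smul_mul, h1], by rw [Y.smul_mul, h2, hf.map_smul]⟩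
      rw [dif_pos h, dif_pos h']
      simp [hf.map_smul]
    · have h' : ¬ ∃ k : G, X.smul k a₀ = X.smul g a ∧ Y.smul k c₀ = f (X.smul g b) := by
        rintro ⟨k, h1, h2⟩
        refine h ⟨g⁻¹ * k, by rw [X.smul_mul, h1, X.inv_smul_smul], ?_⟩
        rw [Y.smul_mul, h2, hf.map_smul, Y.inv_smul_smul]
      rw [dif_neg h, dif_neg h']
      rfl
  proj_t a b := by
    split_ifs <;> rfl

lemma foldData_t_of_mem (hf : IsEllMap f) (a₀ : X.V) (c₀ : Y.V) {a b : X.V}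
    (h : ∃ g : G, X.smul g a₀ = a ∧ Y.smul g c₀ = f b) :
    (foldData hf a₀ c₀).t a b = Sum.inr ⟨(a, f b), h⟩ := dif_pos h

lemma foldData_t_of_not_mem (hf : IsEllMap f) (a₀ : X.V) (c₀ : Y.V) {a b : X.V}
    (h : ¬ ∃ g : G, X.smul g a₀ = a ∧ Y.smul g c₀ = f b) :
    (foldData hf a₀ c₀).t a b = Sum.inl a := dif_neg h

/-- The map from the half-folded tree to `Y`. -/
def foldMap (f : X.V → Y.V) (a₀ : X.V) (c₀ : Y.V) : X.V ⊕ FoldVertex a₀ c₀ → Y.V :=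
  Sum.elim f (fun w => w.1.2)

lemma isEllMap_foldMap (hf : IsEllMap f) {a₀ : X.V} {c₀ : Y.V}
    (h0 : Y.graph.Adj (f a₀) c₀) :
    IsEllMap (X := (foldData hf a₀ c₀).blowUp) (Y := Y) (foldMap f a₀ c₀) where
  map_smul := by
    rintro g (a | w)
    · exact hf.map_smul g a
    · rfl
  map_adj := by
    have hw : ∀ w : FoldVertex a₀ c₀, Y.graph.Adj (f w.1.1) w.1.2 := by
      rintro ⟨⟨a, c⟩, g, h1, h2⟩
      dsimp only at h1 h2 ⊢
      rw [← h1, ← h2, hf.map_smul]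
      exact Y.smul_adj g h0
    have ht : ∀ a b, foldMap f a₀ c₀ ((foldData hf a₀ c₀).t a b) = f a ∨
        foldMap f a₀ c₀ ((foldData hf a₀ c₀).t a b) = f b := by
      intro a b
      by_cases h : ∃ g : G, X.smul g a₀ = a ∧ Y.smul g c₀ = f b
      · rw [foldData_t_of_mem hf a₀ c₀ h]; exact Or.inr rfl
      · rw [foldData_t_of_not_mem hf a₀ c₀ h]; exact Or.inl rfl
    rintro p q (⟨w, rfl, rfl⟩ | ⟨w, rfl, rfl⟩ | ⟨a, b, h, rfl, rfl⟩)
    · exact Or.inr (hw w)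
    · exact Or.inr (hw w).symm
    · have h3 : f b = f a ∨ Y.graph.Adj (f b) (f a) :=
        (hf.map_adj a b h).imp Eq.symm Adj.symm
      rcases ht a b with h1 | h1 <;> rcases ht b a with h2 | h2 <;> rw [h1, h2]
      · exact hf.map_adj a b h
      · exact Or.inl rfl
      · exact Or.inl rfl
      · exact h3
  surj y := by
    obtain ⟨x, rfl⟩ := hf.surj y
    exact ⟨Sum.inl x, rfl⟩
  ell y := by
    obtain ⟨p, hp⟩ := hf.ell y
    exact ⟨Sum.inl p, fun g hg => congrArg Sum.inl (hp g hg)⟩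

/-- The edges contracted by the second half of a fold. -/
def foldRel (f : X.V → Y.V) (a₀ : X.V) (c₀ : Y.V) (u v : X.V ⊕ FoldVertex a₀ c₀) : Prop :=
  ∃ a b, ∃ h : ∃ g : G, X.smul g a₀ = a ∧ Y.smul g c₀ = f b, X.graph.Adj a b ∧
    u = Sum.inr ⟨(a, f b), h⟩ ∧ v = Sum.inl b

lemma isContractible_foldRel (hf : IsEllMap f) {a₀ : X.V} {c₀ : Y.V}
    (h0 : Y.graph.Adj (f a₀) c₀) :
    IsContractible (X := (foldData hf a₀ c₀).blowUp) (Y := Y) (foldMap f a₀ c₀)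
      (foldRel f a₀ c₀) where
  adj := by
    rintro _ _ ⟨a, b, h, hab, rfl, rfl⟩
    have hn : ¬ ∃ k : G, X.smul k a₀ = b ∧ Y.smul k c₀ = f a := by
      rintro ⟨k, h3, h4⟩
      obtain ⟨g, h1, h2⟩ := h
      refine Y.no_inversions (g⁻¹ * k) _ _ h0 ⟨?_, ?_⟩
      · rw [Y.smul_mul, ← hf.map_smul, h3, ← h2, Y.inv_smul_smul]
      · rw [Y.smul_mul, h4, ← h1, hf.map_smul, Y.inv_smul_smul]
    have := (foldData hf a₀ c₀).adj_t hab
    rwa [foldData_t_of_mem hf a₀ c₀ h, foldData_t_of_not_mem hf a₀ c₀ hn] at this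
  map_eq := by
    rintro _ _ ⟨a, b, h, hab, rfl, rfl⟩
    rfl
  smul := by
    rintro g _ _ ⟨a, b, ⟨k, h1, h2⟩, hab, rfl, rfl⟩
    refine ⟨X.smul g a, X.smul g b, ⟨g * k, ?_, ?_⟩, X.smul_adj g hab, ?_, rfl⟩
    · rw [X.smul_mul, h1]
    · rw [Y.smul_mul, h2, hf.map_smul]
    · refine congrArg Sum.inr (Subtype.ext (Prod.ext rfl ?_))
      exact (hf.map_smul g b).symm

/-- A fold of two edges with the same image is an elementary deformation. -/
lemma exists_fold (hf : IsEllMap f) (hX : VFinite X) {a₀ b₁ b₂ : X.V} {c₀ : Y.V}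
    (h1 : X.graph.Adj a₀ b₁) (h2 : X.graph.Adj a₀ b₂) (hb1 : f b₁ = c₀) (hb2 : f b₂ = c₀)
    (h0 : Y.graph.Adj (f a₀) c₀) :
    ∃ (X' : GTree G) (f' : X'.V → Y.V) (ρ : X.V → X'.V), ElemDeformation X X' ∧ IsEllMap f' ∧
      Function.Surjective ρ ∧ (∀ g x, ρ (X.smul g x) = X'.smul g (ρ x)) ∧
      (∀ x, f' (ρ x) = f x) ∧ ρ b₁ = ρ b₂ := by
  have hF := isEllMap_foldMap hf h0
  have hR := isContractible_foldRel hf h0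
  have hZ : VFinite (foldData hf a₀ c₀).blowUp := by
    obtain ⟨K, hK, hKX⟩ := hX
    refine ⟨Sum.inl '' K ∪ {Sum.inr ⟨(a₀, c₀), 1, X.smul_one _, Y.smul_one _⟩},
      (hK.image _).union (Set.finite_singleton _), ?_⟩
    rintro (x | ⟨⟨a, c⟩, g, h1, h2⟩)
    · obtain ⟨g, hg⟩ := hKX x
      exact ⟨g, Or.inl ⟨_, hg, rfl⟩⟩
    · refine ⟨g⁻¹, Or.inr (congrArg Sum.inr (Subtype.ext (Prod.ext ?_ ?_)))⟩
      · exact (X.smul_eq_iff.mp h1 ▸ rfl : X.smul g⁻¹ a = a₀)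
      · exact (Y.smul_eq_iff.mp h2 ▸ rfl : Y.smul g⁻¹ c = c₀)
  refine ⟨contract hF hR, Quot.lift _ hR.map_eq, fun x => Quot.mk _ (Sum.inl x), ?_,
    contract_lift hF hR, ?_, fun _ _ => rfl, fun _ => rfl, ?_⟩
  · exact (Relation.EqvGen.symm _ _ ((foldData hf a₀ c₀).isContraction_proj.elemDeformation
      hZ)).trans _ _ _ ((contract_mk hF hR).elemDeformation hZ)
  · rintro ⟨(x | ⟨⟨a, c⟩, g, ha, hc⟩)⟩
    · exact ⟨x, rfl⟩
    · dsimp only at ha hc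
      subst ha hc
      refine ⟨X.smul g b₁, (Quot.sound ⟨X.smul g a₀, X.smul g b₁, ⟨g, rfl, ?_⟩,
        X.smul_adj g h1, ?_, rfl⟩).symm⟩
      · rw [hf.map_smul, hb1]
      · refine congrArg Sum.inr (Subtype.ext (Prod.ext rfl ?_))
        change Y.smul g c₀ = f _
        rw [hf.map_smul, hb1]
  · have e : ∀ b, X.graph.Adj a₀ b → f b = c₀ → (Quot.mk (foldRel f a₀ c₀) (Sum.inl b)) =
        Quot.mk _ (Sum.inr ⟨(a₀, c₀), 1, X.smul_one _, Y.smul_one _⟩) := by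
      rintro b hab rfl
      exact (Quot.sound ⟨a₀, b, ⟨1, X.smul_one _, Y.smul_one _⟩, hab, rfl, rfl⟩).symm
    exact (e b₁ h1 hb1).trans (e b₂ h2 hb2).symm

/-- An `IsEllMap` with finite fibres is a composition of folds and collapses. -/
lemma IsEllMap.elemDeformation (hf : IsEllMap f) (hX : VFinite X)
    (hfib : ∀ y, (f ⁻¹' {y}).Finite) : ElemDeformation X Y := by
  obtain ⟨K, hK, hKY⟩ : VFinite Y := by
    obtain ⟨K, hK, hKX⟩ := hX
    refine ⟨f '' K, hK.image f, fun y => ?_⟩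
    obtain ⟨x, rfl⟩ := hf.surj y
    obtain ⟨g, hg⟩ := hKX x
    exact ⟨g, _, hg, hf.map_smul g x⟩
  obtain ⟨n, hn⟩ : ∃ n, (f ⁻¹' K).ncard = n := ⟨_, rfl⟩
  induction n using Nat.strong_induction_on generalizing X with
  | _ n ih =>
  by_cases hinj : Function.Injective f
  · exact (hf.isGIso hinj).elemDeformation
  have step : ∀ (X' : GTree G) (f' : X'.V → Y.V) (ρ : X.V → X'.V) (b₁ b₂ : X.V),
      ElemDeformation X X' → IsEllMap f' → Function.Surjective ρ →
      (∀ g x, ρ (X.smul g x) = X'.smul g (ρ x)) → (∀ x, f' (ρ x) = f x) → ρ b₁ = ρ b₂ →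
      b₁ ≠ b₂ → ElemDeformation X Y := by
    intro X' f' ρ b₁ b₂ hXX' hf' hρs hρ hfρ hb hne
    refine hXX'.trans _ _ _ ?_
    have himg : ∀ S : Set Y.V, f' ⁻¹' S = ρ '' (f ⁻¹' S) := by
      intro S
      ext x'
      obtain ⟨x, rfl⟩ := hρs x'
      constructor
      · intro h
        exact ⟨x, by simpa [hfρ] using h, rfl⟩
      · rintro ⟨z, hz, hzx⟩
        rw [← hzx, Set.mem_preimage, hfρ]
        exact hz
    have hfin : (f ⁻¹' K).Finite := by
      rw [← Set.biUnion_preimage_singleton]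
      exact hK.biUnion fun y _ => hfib y
    refine ih (f' ⁻¹' K).ncard ?_ hf' ?_ ?_ rfl
    · obtain ⟨g, hg⟩ := hKY (f b₁)
      rw [← hn, himg]
      have hρb : ρ (X.smul g b₁) = ρ (X.smul g b₂) := by rw [hρ, hρ, hb]
      refine lt_of_le_of_ne (Set.ncard_image_le hfin) fun h => hne ?_
      rw [Set.ncard_image_iff hfin] at h
      apply X.smul_injective g
      refine h ?_ ?_ hρb
      · simpa [hf.map_smul] using hg
      · rw [Set.mem_preimage, ← hfρ, ← hρb, hfρ, hf.map_smul]
        exact hg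
    · obtain ⟨L, hL, hLX⟩ := hX
      refine ⟨ρ '' L, hL.image ρ, fun x' => ?_⟩
      obtain ⟨x, rfl⟩ := hρs x'
      obtain ⟨g, hg⟩ := hLX x
      exact ⟨g, _, hg, hρ g x⟩
    · intro y
      rw [himg]
      exact (hfib y).image ρ
  by_cases hadj : ∀ u v, X.graph.Adj u v → f u ≠ f v
  · have : ∃ a b c, X.graph.Adj a b ∧ X.graph.Adj a c ∧ f b = f c ∧ b ≠ c := by
      by_contra! hcon
      exact hinj (hf.injective_of_locally_injective hadj hcon)
    obtain ⟨a, b, c, hab, hac, hbc, hne⟩ := this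
    obtain ⟨X', f', ρ, h1, h2, h3, h4, h5, h6⟩ := exists_fold hf hX hab hac hbc rfl
      ((hf.map_adj a c hac).resolve_left (hadj a c hac))
    exact step X' f' ρ b c h1 h2 h3 h4 h5 h6 hne
  · push Not at hadj
    obtain ⟨u, v, huv, hfuv⟩ := hadj
    have hR := isContractible_orbit hf huv hfuv
    exact step (contract hf hR) (Quot.lift f hR.map_eq) (Quot.mk _) u v
      ((contract_mk hf hR).elemDeformation hX) (contract_lift hf hR) Quot.mk_surjective
      (fun _ _ => rfl) (fun _ => rfl) (Quot.sound ⟨1, (X.smul_one _).symm, (X.smul_one _).symm⟩)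
      huv.ne

end GTree

namespace GTree

open SimpleGraph

variable {G : Type u} [Group G]

/-- Orbit equivalence of vertices, generated as in the definition of the quotient graph. -/
lemma exists_smul_eq_of_mk_eq {X : GTree G} {x y : X.V}
    (h : Quot.mk (fun x y : X.V => ∃ γ, X.smul γ x = y) x = Quot.mk _ y) :
    ∃ γ, X.smul γ x = y := by
  have := Quot.eqvGen_exact h
  clear h
  induction this with
  | rel _ _ h => exact h
  | refl x => exact ⟨1, X.smul_one x⟩
  | symm _ _ _ ih =>
    obtain ⟨γ, rfl⟩ := ih
    exact ⟨γ⁻¹, X.inv_smul_smul _ _⟩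
  | trans _ _ _ _ _ ih1 ih2 =>
    obtain ⟨γ, rfl⟩ := ih1
    obtain ⟨δ, rfl⟩ := ih2
    exact ⟨δ * γ, X.smul_mul _ _ _⟩

lemma exists_edgeSmul_eq_of_mk_eq {X : GTree G} {e f : X.Edge}
    (h : Quot.mk (fun e f : X.Edge => ∃ γ, edgeSmul γ e = f) e = Quot.mk _ f) :
    ∃ γ, edgeSmul γ e = f := by
  have := Quot.eqvGen_exact h
  clear h
  induction this with
  | rel _ _ h => exact h
  | refl x => exact ⟨1, Subtype.ext (Prod.ext (X.smul_one _) (X.smul_one _))⟩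
  | symm _ _ _ ih =>
    obtain ⟨γ, rfl⟩ := ih
    exact ⟨γ⁻¹, Subtype.ext (Prod.ext (X.inv_smul_smul _ _) (X.inv_smul_smul _ _))⟩
  | trans _ _ _ _ _ ih1 ih2 =>
    obtain ⟨γ, rfl⟩ := ih1
    obtain ⟨δ, rfl⟩ := ih2
    exact ⟨δ * γ, Subtype.ext (Prod.ext (X.smul_mul _ _ _) (X.smul_mul _ _ _))⟩

/-- If the vertex stabilizers of `Y` are elliptic in `X`, there is an equivariant map of
vertices. -/
lemma exists_equivariant {X Y : GTree G} (h : ∀ y, X.FixesVertex (Y.stab y)) :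
    ∃ s : Y.V → X.V, ∀ g y, s (Y.smul g y) = X.smul g (s y) := by
  let rel : Y.V → Y.V → Prop := fun x y => ∃ γ, Y.smul γ x = y
  let r : Y.V → Y.V := fun y => (Quot.mk rel y).out
  have hr : ∀ y, ∃ g, Y.smul g (r y) = y := fun y =>
    exists_smul_eq_of_mk_eq (Quot.out_eq (Quot.mk rel y))
  choose g hg using hr
  choose p hp using h
  refine ⟨fun y => X.smul (g y) (p (r y)), fun k y => ?_⟩
  have hrk : r (Y.smul k y) = r y := by
    have : Quot.mk rel (Y.smul k y) = Quot.mk rel y := (Quot.sound ⟨k, rfl⟩).symm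
    simp only [r, this]
  have h1 : (k * g y)⁻¹ * g (Y.smul k y) ∈ Y.stab (r y) := by
    rw [mem_stab, Y.smul_mul]
    have := hg (Y.smul k y)
    rw [hrk] at this
    rw [this, Y.smul_eq_iff, inv_inv, Y.smul_mul, hg]
  have h2 := hp _ _ h1
  beta_reduce
  rw [hrk, ← X.smul_mul]
  rw [X.smul_mul, X.smul_eq_iff, inv_inv] at h2
  exact h2

/-- Finiteness conditions on a `G`-tree preserved by the constructions below. -/
structure Tame (X : GTree G) : Prop where
  vfin : VFinite X
  efin : ∃ K : Set (X.V × X.V), K.Finite ∧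
    ∀ a b, X.graph.Adj a b → ∃ g, (X.smul g a, X.smul g b) ∈ K
  vinf : ∀ x, (X.stab x : Set G).Infinite
  einf : ∀ a b, X.graph.Adj a b → ((X.stab a ⊓ X.stab b : Subgroup G) : Set G).Infinite

lemma IsGBSTree.tame {X : GTree G} (h : X.IsGBSTree) (hc : X.Cocompact) : Tame X where
  vfin := by
    have := hc.1
    refine ⟨Set.range fun q : Quot fun x y : X.V => ∃ γ, X.smul γ x = y => q.out,
      Set.finite_range _, fun x => ?_⟩
    obtain ⟨g, hg⟩ := exists_smul_eq_of_mk_eq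
      (Quot.out_eq (Quot.mk (fun x y : X.V => ∃ γ, X.smul γ x = y) x)).symm
    exact ⟨g, _, hg.symm⟩
  efin := by
    have := hc.2
    refine ⟨Set.range fun q : Quot fun e f : X.Edge => ∃ γ, edgeSmul γ e = f => q.out.1,
      Set.finite_range _, fun a b hab => ?_⟩
    obtain ⟨g, hg⟩ := exists_edgeSmul_eq_of_mk_eq
      (Quot.out_eq (Quot.mk (fun e f : X.Edge => ∃ γ, edgeSmul γ e = f) ⟨(a, b), hab⟩)).symm
    exact ⟨g, _, congrArg Subtype.val hg.symm⟩
  vinf x := Set.infinite_coe_iff.mp (h.1 x).2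
  einf a b hab := Set.infinite_coe_iff.mp (h.2 ⟨(a, b), hab⟩).2

lemma BlowUpData.tame {X : GTree G} {W : Type u} (D : BlowUpData X W) (hX : Tame X)
    (hW : ∃ K : Set W, K.Finite ∧ ∀ w, ∃ g, D.act g w ∈ K)
    (hinf : ∀ w, {g | D.act g w = w}.Infinite) : Tame D.blowUp := by
  obtain ⟨KW, hKW, hKW'⟩ := hW
  have hw : ∀ w, ({g | D.act g w = w} : Set G) ⊆
      ((D.blowUp.stab (Sum.inl (D.s w)) ⊓ D.blowUp.stab (Sum.inr w) : Subgroup G) : Set G) := by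
    intro w g hg
    refine ⟨congrArg Sum.inl ?_, congrArg Sum.inr hg⟩
    rw [← D.s_act, hg]
  have ht : ∀ a b g, g ∈ X.stab a → g ∈ X.stab b → g ∈ D.blowUp.stab (D.t a b) := by
    intro a b g ha hb
    have := D.t_smul g a b
    rw [ha, hb] at this
    exact this.symm
  refine ⟨?_, ?_, ?_, ?_⟩
  · obtain ⟨K, hK, hKX⟩ := hX.vfin
    refine ⟨Sum.inl '' K ∪ Sum.inr '' KW, (hK.image _).union (hKW.image _), ?_⟩
    rintro (x | w)
    · obtain ⟨g, hg⟩ := hKX x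
      exact ⟨g, Or.inl ⟨_, hg, rfl⟩⟩
    · obtain ⟨g, hg⟩ := hKW' w
      exact ⟨g, Or.inr ⟨_, hg, rfl⟩⟩
  · obtain ⟨K, hK, hKX⟩ := hX.efin
    refine ⟨((fun w => (Sum.inl (D.s w), Sum.inr w)) '' KW ∪
      (fun w => (Sum.inr w, Sum.inl (D.s w))) '' KW) ∪ (fun p => (D.t p.1 p.2, D.t p.2 p.1)) '' K,
      ((hKW.image _).union (hKW.image _)).union (hK.image _), ?_⟩
    rintro p q (⟨w, rfl, rfl⟩ | ⟨w, rfl, rfl⟩ | ⟨a, b, h, rfl, rfl⟩)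
    · obtain ⟨g, hg⟩ := hKW' w
      exact ⟨g, Or.inl (Or.inl ⟨_, hg, Prod.ext (congrArg Sum.inl (D.s_act g w)) rfl⟩)⟩
    · obtain ⟨g, hg⟩ := hKW' w
      exact ⟨g, Or.inl (Or.inr ⟨_, hg, Prod.ext rfl (congrArg Sum.inl (D.s_act g w))⟩)⟩
    · obtain ⟨g, hg⟩ := hKX a b h
      exact ⟨g, Or.inr ⟨_, hg, Prod.ext (D.t_smul g a b) (D.t_smul g b a)⟩⟩
  · rintro (x | w)
    · exact (hX.vinf x).mono fun g hg => congrArg Sum.inl hg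
    · exact (hinf w).mono fun g hg => (hw w hg).2
  · rintro p q (⟨w, rfl, rfl⟩ | ⟨w, rfl, rfl⟩ | ⟨a, b, h, rfl, rfl⟩)
    · exact (hinf w).mono (hw w)
    · exact (hinf w).mono fun g hg => (hw w hg).symm
    · exact (hX.einf a b h).mono fun g hg => ⟨ht a b g hg.1 hg.2, ht b a g hg.2 hg.1⟩

lemma exists_zpow_of_isCyclic {H : Subgroup G} (hH : IsCyclic H) :
    ∃ c ∈ H, ∀ h ∈ H, ∃ n : ℤ, c ^ n = h := by
  obtain ⟨c, hc⟩ := hH.exists_generator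
  refine ⟨c, c.2, fun h hh => ?_⟩
  obtain ⟨n, hn⟩ := hc ⟨h, hh⟩
  exact ⟨n, by simpa using congrArg Subtype.val hn⟩

lemma finite_fibre {X Y : GTree G} (hX : VFinite X) (hinf : ∀ x, (X.stab x : Set G).Infinite)
    (hY : ∀ y, IsCyclic (Y.stab y)) {f : X.V → Y.V}
    (hf : ∀ g x, f (X.smul g x) = Y.smul g (f x)) (y : Y.V) : (f ⁻¹' {y}).Finite := by
  obtain ⟨K, hK, hKX⟩ := hX
  have hsub : f ⁻¹' {y} ⊆ ⋃ k ∈ K, {x | f x = y ∧ ∃ g, X.smul g x = k} := by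
    intro x hx
    obtain ⟨g, hg⟩ := hKX x
    exact Set.mem_biUnion hg ⟨hx, g, rfl⟩
  refine Set.Finite.subset (hK.biUnion fun k _ => ?_) hsub
  obtain ⟨c, hcy, hc⟩ := exists_zpow_of_isCyclic (hY y)
  by_cases hne : ∃ x0, f x0 = y ∧ ∃ g, X.smul g x0 = k
  swap
  · convert Set.finite_empty
    ext x
    exact ⟨fun h => hne ⟨x, h⟩, fun h => h.elim⟩
  obtain ⟨x0, hx0, g0, rfl⟩ := hne
  obtain ⟨d, hd, hd1⟩ := (hinf x0).exists_notMem_finite (Set.finite_singleton (1 : G))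
  obtain ⟨m, rfl⟩ := hc d (by rw [mem_stab, ← hx0, ← hf, hd])
  have hm : m ≠ 0 := by
    rintro rfl
    simp at hd1
  refine Set.Finite.subset ((Set.finite_Ico (0 : ℤ) |m|).image fun i => X.smul (c ^ i) x0) ?_
  rintro x ⟨hx, g, hg⟩
  rw [X.smul_eq_iff, ← X.smul_mul] at hg
  obtain ⟨i, hi⟩ := hc (g⁻¹ * g0) (by rw [mem_stab, ← hx0, ← hf, ← hg, hx, hx0])
  refine ⟨i % m, ⟨Int.emod_nonneg _ hm, Int.emod_lt_abs _ hm⟩, ?_⟩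
  have h1 : c ^ i = c ^ (i % m) * (c ^ m) ^ (i / m) := by
    rw [← zpow_mul, ← zpow_add, Int.emod_add_mul_ediv]
  have h2 : X.smul ((c ^ m) ^ (i / m)) x0 = x0 := Subgroup.zpow_mem _ hd (i / m)
  rw [hg, ← hi, h1, X.smul_mul, h2]

/-- The data for subdividing each edge into three. -/
noncomputable def subdivData (X : GTree G) : BlowUpData X X.Edge := by
  classical
  exact
  { act := edgeSmul
    act_one := fun _ => Subtype.ext (Prod.ext (X.smul_one _) (X.smul_one _))
    act_mul := fun _ _ _ => Subtype.ext (Prod.ext (X.smul_mul _ _ _) (X.smul_mul _ _ _))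
    s := d0
    s_act := fun _ _ => rfl
    t := fun a b => if h : X.graph.Adj a b then Sum.inr ⟨(a, b), h⟩ else Sum.inl a
    t_smul := fun g a b => by
      by_cases h : X.graph.Adj a b
      · rw [dif_pos h, dif_pos (X.smul_adj g h)]
        rfl
      · rw [dif_neg h, dif_neg (by rwa [X.adj_smul_iff])]
        rfl
    proj_t := fun a b => by split_ifs <;> rfl }

lemma subdivData_t {X : GTree G} {a b : X.V} (h : X.graph.Adj a b) :
    X.subdivData.t a b = Sum.inr ⟨(a, b), h⟩ := dif_pos h

lemma tame_subdiv {X : GTree G} (hX : Tame X) : Tame X.subdivData.blowUp := by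
  refine X.subdivData.tame hX ?_ ?_
  · obtain ⟨K, hK, hKX⟩ := hX.efin
    refine ⟨Subtype.val ⁻¹' K, hK.preimage Subtype.val_injective.injOn, fun e => hKX _ _ e.2⟩
  · intro e
    exact (hX.einf _ _ e.2).mono fun g hg => Subtype.ext (Prod.ext hg.1 hg.2)

lemma _root_.SimpleGraph.IsTree.dist_toward_toward_le {V : Type*} {T : SimpleGraph V}
    (hT : T.IsTree) {u v : V} {n : ℕ} (hn : 1 ≤ n) (h : T.dist u v ≤ n + 1) :
    T.dist (T.toward u v) (T.toward v u) ≤ n := by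
  by_cases huv : u = v
  · subst huv
    simp
  obtain ⟨h1, h2⟩ := hT.toward_spec huv
  by_cases hv : T.toward u v = v
  · rw [hv] at h1
    rw [hv, hT.toward_adj h1.symm, T.dist_comm, dist_eq_one_iff_adj.mpr h1]
    exact hn
  · have h4 := hT.dist_pos hv
    have h3 : T.toward v u = T.toward v (T.toward u v) := by
      apply hT.toward_eq_of_dist_lt
      rw [dist_eq_one_iff_adj.mpr h1, T.dist_comm]
      omega
    obtain ⟨h5, h6⟩ := hT.toward_spec (Ne.symm hv)
    rw [h3, T.dist_comm]
    rw [T.dist_comm] at h6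
    omega

/-- An equivariant surjection on vertices which is elliptic on stabilizers yields an
elementary deformation. -/
lemma elemDeformation_of_surjective {X Y : GTree G} (hX : Tame X)
    (hY : ∀ y, IsCyclic (Y.stab y)) {f : X.V → Y.V}
    (hf : ∀ g x, f (X.smul g x) = Y.smul g (f x)) (hsurj : Function.Surjective f)
    (hell : ∀ y, X.FixesVertex (Y.stab y)) (n : ℕ)
    (hn : ∀ a b, X.graph.Adj a b → Y.graph.dist (f a) (f b) ≤ n + 1) : ElemDeformation X Y := by
  induction n generalizing X with
  | zero =>
    refine IsEllMap.elemDeformation (f := f) ⟨hf, fun u v h => ?_, hsurj, hell⟩ hX.vfin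
      (finite_fibre hX.vfin hX.vinf hY hf)
    rcases Nat.le_one_iff_eq_zero_or_eq_one.mp (hn u v h) with h | h
    · exact Or.inl (Y.isTree.dist_eq_zero.mp h)
    · exact Or.inr (dist_eq_one_iff_adj.mp h)
  | succ n ih =>
    have hX' := tame_subdiv hX
    refine (Relation.EqvGen.symm _ _ (X.subdivData.isContraction_proj.elemDeformation
      hX'.vfin)).trans _ _ _ ?_
    have hleaf : ∀ e : X.Edge, Y.graph.dist (f (d0 e)) (Y.graph.toward (f (d0 e)) (f (d1 e))) ≤
        n + 1 := by
      intro e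
      by_cases h : f (d0 e) = f (d1 e)
      · rw [h, IsTree.toward_self, SimpleGraph.dist_self]
        omega
      · rw [dist_eq_one_iff_adj.mpr (Y.isTree.toward_spec h).1]
        omega
    refine ih (X := X.subdivData.blowUp) hX'
      (f := Sum.elim f fun e => Y.graph.toward (f (d0 e)) (f (d1 e))) ?_ ?_ ?_ ?_
    · rintro g (a | e)
      · exact hf g a
      · change Y.graph.toward (f (X.smul g (d0 e))) (f (X.smul g (d1 e))) = Y.smul g _
        rw [hf, hf, toward_smul]
        rfl
    · intro y
      obtain ⟨x, rfl⟩ := hsurj y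
      exact ⟨Sum.inl x, rfl⟩
    · intro y
      obtain ⟨p, hp⟩ := hell y
      exact ⟨Sum.inl p, fun g hg => congrArg Sum.inl (hp g hg)⟩
    · rintro p q (⟨e, rfl, rfl⟩ | ⟨e, rfl, rfl⟩ | ⟨a, b, h, rfl, rfl⟩)
      · exact hleaf e
      · rw [Y.graph.dist_comm]
        exact hleaf e
      · rw [subdivData_t h, subdivData_t h.symm]
        exact Y.isTree.dist_toward_toward_le (by omega) (hn a b h)

/-- Two cocompact generalized Baumslag–Solitar trees whose vertex stabilizers are mutually
elliptic are related by an elementary deformation. -/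
lemma elemDeformation_of_stab {X Y : GTree G} (hXc : X.Cocompact) (hYc : Y.Cocompact)
    (hX : X.IsGBSTree) (hY : Y.IsGBSTree) (h1 : ∀ y, X.FixesVertex (Y.stab y))
    (h2 : ∀ x, Y.FixesVertex (X.stab x)) : ElemDeformation X Y := by
  obtain ⟨s, hs⟩ := exists_equivariant h1
  obtain ⟨f, hf⟩ := exists_equivariant h2
  let D : BlowUpData X Y.V :=
    { act := Y.smul
      act_one := Y.smul_one
      act_mul := Y.smul_mul
      s := s
      s_act := hs
      t := fun a _ => Sum.inl a
      t_smul := fun _ _ _ => rfl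
      proj_t := fun _ _ => rfl }
  have hD : Tame D.blowUp := D.tame (hX.tame hXc) (hY.tame hYc).vfin (hY.tame hYc).vinf
  refine (Relation.EqvGen.symm _ _ (D.isContraction_proj.elemDeformation hD.vfin)).trans _ _ _ ?_
  let F : D.blowUp.V → Y.V := Sum.elim f id
  have hF : ∀ g x, F (D.blowUp.smul g x) = Y.smul g (F x) := by
    rintro g (x | y)
    · exact hf g x
    · rfl
  obtain ⟨n, hn⟩ : ∃ n, ∀ a b, D.blowUp.graph.Adj a b → Y.graph.dist (F a) (F b) ≤ n + 1 := by
    obtain ⟨K, hK, hKX⟩ := hD.efin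
    obtain ⟨n, hn⟩ := (hK.image fun p => Y.graph.dist (F p.1) (F p.2)).bddAbove
    refine ⟨n, fun a b hab => ?_⟩
    obtain ⟨g, hg⟩ := hKX a b hab
    have := hn ⟨_, hg, rfl⟩
    simp only [hF, dist_smul] at this
    omega
  exact elemDeformation_of_surjective hD (fun y => (hY.1 y).1) hF (fun y => ⟨Sum.inr y, rfl⟩)
    (fun y => ⟨Sum.inr y, fun g hg => congrArg Sum.inr hg⟩) n hn

end GTree

namespace SimpleGraph.IsTree

variable {V : Type*} {T : SimpleGraph V}

lemma toward_eq_of_btw (hT : T.IsTree) {x u v : V} (h : T.IsBtw x u v) (hne : x ≠ u) :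
    T.toward x v = T.toward x u := by
  obtain ⟨h1, h2⟩ := hT.toward_spec hne
  apply hT.eq_toward h1
  have h3 := hT.dist_triangle (T.toward x u) u v
  unfold IsBtw at h
  rcases hT.dist_adj v h1 with h4 | h4 <;> omega

/-- Every walk passes through all vertices of the geodesic between its ends. -/
lemma mem_support_of_btw (hT : T.IsTree) {p v q : V} (h : T.IsBtw p v q) (W : T.Walk p q) :
    v ∈ W.support := by
  induction W with
  | @nil p =>
    have : v = p := by
      apply hT.dist_eq_zero.mp
      unfold IsBtw at h
      rw [SimpleGraph.dist_self] at h
      exact (Nat.add_eq_zero_iff.mp h).2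
    simp [this]
  | @cons p p' q hpp W ih =>
    by_cases hv : p = v
    · simp [hv]
    rw [Walk.support_cons]
    refine List.mem_cons_of_mem _ (ih ?_)
    have h0 := hT.toward_eq_of_btw h hv
    have h1 := hT.dist_triangle p' v q
    unfold IsBtw at h ⊢
    rcases hT.dist_adj v hpp with h2 | h2 <;> rcases hT.dist_adj q hpp with h3 | h3
    · omega
    · omega
    · rw [hT.eq_toward hpp h3] at h0
      have := (hT.toward_spec hv).2
      rw [← h0] at this
      omega
    · omega

lemma eq_toward_of_btw (hT : T.IsTree) {p v q a : V} (hv : T.IsBtw p v q) (ha : T.IsBtw p a q)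
    (h : T.Adj v a) : a = T.toward v p ∨ a = T.toward v q := by
  by_contra! hcon
  have h1 := hT.dist_of_ne_toward h hcon.1.symm
  have h2 := hT.dist_of_ne_toward h hcon.2.symm
  unfold IsBtw at *
  rw [T.dist_comm (u := p)] at hv ha
  omega

end SimpleGraph.IsTree

namespace GTree

open SimpleGraph

variable {G : Type u} [Group G]

/-- A vertex of minimal displacement of an element without fixed vertices lies between its
translates. -/
lemma exists_btw_of_not_fixed (Y : GTree G) {h : G} (hh : ∀ y, Y.smul h y ≠ y) :
    ∃ x, Y.graph.IsBtw x (Y.smul h x) (Y.smul h (Y.smul h x)) := by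
  have := Y.isTree.connected.nonempty
  obtain ⟨x, hx⟩ : ∃ x, ∀ y, Y.graph.dist x (Y.smul h x) ≤ Y.graph.dist y (Y.smul h y) :=
    ⟨Function.argmin fun x => Y.graph.dist x (Y.smul h x), fun y =>
      Function.argmin_le (fun x => Y.graph.dist x (Y.smul h x)) y⟩
  refine ⟨x, Y.isTree.btw_of_toward_ne fun heq => ?_⟩
  rw [toward_smul] at heq
  have hpos := Y.isTree.dist_pos (hh x).symm
  obtain ⟨n, hn⟩ : ∃ n, Y.graph.dist x (Y.smul h x) = n + 1 := ⟨_, (Nat.sub_add_cancel hpos).symm⟩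
  by_cases h0 : n = 0
  · subst h0
    have hadj : Y.graph.Adj x (Y.smul h x) := dist_eq_one_iff_adj.mp hn
    rw [Y.isTree.toward_adj hadj, Y.isTree.toward_adj hadj.symm] at heq
    exact Y.no_inversions h _ _ hadj ⟨rfl, heq.symm⟩
  · have h1 := Y.isTree.dist_toward_toward_le (by omega) hn.le
    rw [heq] at h1
    have h2 := hx (Y.graph.toward x (Y.smul h x))
    omega

/-- Translation along an axis. -/
lemma dist_pow_smul (Y : GTree G) {h : G} {x : Y.V} (hne : Y.smul h x ≠ x)
    (hb : Y.graph.IsBtw x (Y.smul h x) (Y.smul h (Y.smul h x))) (N : ℕ) :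
    Y.graph.dist x (Y.smul (h ^ N) x) = N * Y.graph.dist x (Y.smul h x) := by
  have hsucc : ∀ k, Y.smul (h ^ (k + 1)) x = Y.smul h (Y.smul (h ^ k) x) := fun k => by
    rw [pow_succ', Y.smul_mul]
  induction N using Nat.strong_induction_on with
  | _ N ih =>
  rcases N with _ | _ | N
  · simp [Y.smul_one]
  · simp
  have hlt : Y.graph.toward x (Y.smul (h ^ (N + 1)) x) = Y.graph.toward x (Y.smul h x) := by
    apply Y.isTree.toward_eq_of_btw _ hne.symm
    unfold IsBtw
    rw [ih (N + 1) (by omega), hsucc, dist_smul, ih N (by omega)]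
    ring
  have h1 : Y.graph.IsBtw x (Y.smul h x) (Y.smul (h ^ (N + 2)) x) := by
    apply Y.isTree.btw_of_toward_ne
    rw [hsucc, toward_smul, hlt, ← toward_smul]
    exact Y.isTree.toward_ne_of_btw hb hne (fun h' => hne (Y.smul_injective h h').symm)
  unfold IsBtw at h1
  rw [← h1, hsucc, dist_smul, ih (N + 1) (by omega)]
  ring

lemma dist_zpow_smul (Y : GTree G) {h : G} {x : Y.V} (hne : Y.smul h x ≠ x)
    (hb : Y.graph.IsBtw x (Y.smul h x) (Y.smul h (Y.smul h x))) (N : ℤ) :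
    Y.graph.dist x (Y.smul (h ^ N) x) = N.natAbs * Y.graph.dist x (Y.smul h x) := by
  obtain ⟨n, rfl | rfl⟩ := N.eq_nat_or_neg
  · rw [zpow_natCast, Y.dist_pow_smul hne hb, Int.natAbs_natCast]
  · rw [Int.natAbs_neg, Int.natAbs_natCast, ← Y.dist_pow_smul hne hb, zpow_neg, zpow_natCast,
      ← Y.dist_smul (h ^ n), smul_inv_smul, Y.graph.dist_comm]

/-- The vertices eventually separating the orbit points of some power of `h`. -/
def axis (Y : GTree G) (h : G) : Set Y.V :=
  {v | ∃ n : ℤ, n ≠ 0 ∧ ∀ y, ∃ N₀ : ℕ, ∀ N : ℤ, N₀ ≤ N.natAbs →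
    Y.graph.IsBtw (Y.smul (h ^ (-(n * N))) y) v (Y.smul (h ^ (n * N)) y)}

lemma mem_axis (Y : GTree G) {h : G} {x : Y.V} (hne : Y.smul h x ≠ x)
    (hb : Y.graph.IsBtw x (Y.smul h x) (Y.smul h (Y.smul h x))) : x ∈ Y.axis h := by
  refine ⟨1, one_ne_zero, fun y => ⟨Y.graph.dist x y + 1, fun N hN => ?_⟩⟩
  have hd := Y.dist_zpow_smul hne hb
  have hpos := Y.isTree.dist_pos hne.symm
  have hlt : Y.graph.dist x y < N.natAbs * Y.graph.dist x (Y.smul h x) :=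
    lt_of_lt_of_le (by omega) (Nat.le_mul_of_pos_right _ hpos)
  rw [one_mul]
  refine Y.isTree.btw_of_dist_lt (p := Y.smul (h ^ (-N)) x) (q := Y.smul (h ^ N) x) ?_ ?_ ?_
  · unfold IsBtw
    rw [Y.graph.dist_comm, hd, hd, ← Y.dist_smul (h ^ N) (Y.smul (h ^ (-N)) x), ← Y.smul_mul,
      ← Y.smul_mul, ← zpow_add, ← zpow_add, add_neg_cancel, zpow_zero, Y.smul_one, hd,
      Int.natAbs_neg, ← two_mul, ← two_mul N, Int.natAbs_mul]
    exact (mul_assoc 2 _ _).symm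
  · rwa [dist_smul, hd, Int.natAbs_neg]
  · rwa [dist_smul, hd]

lemma axis_common (Y : GTree G) {h : G} (s : Finset Y.V) (hs : ∀ v ∈ s, v ∈ Y.axis h) :
    ∃ n : ℤ, n ≠ 0 ∧ ∀ z, ∃ N₀ : ℕ, ∀ N : ℤ, N₀ ≤ N.natAbs → ∀ v ∈ s,
      Y.graph.IsBtw (Y.smul (h ^ (-(n * N))) z) v (Y.smul (h ^ (n * N)) z) := by
  classical
  induction s using Finset.induction_on with
  | empty => exact ⟨1, one_ne_zero, fun _ => ⟨0, by simp⟩⟩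
  | insert a s _ ih =>
    obtain ⟨n, hn, h1⟩ := ih fun v hv => hs v (Finset.mem_insert_of_mem hv)
    obtain ⟨m, hm, h2⟩ := hs a (Finset.mem_insert_self _ _)
    refine ⟨n * m, mul_ne_zero hn hm, fun z => ?_⟩
    obtain ⟨N₁, h1⟩ := h1 z
    obtain ⟨N₂, h2⟩ := h2 z
    refine ⟨max N₁ N₂, fun N hN v hv => ?_⟩
    have hmul : ∀ k : ℤ, k ≠ 0 → N.natAbs ≤ (k * N).natAbs := fun k hk => by
      rw [Int.natAbs_mul]
      exact Nat.le_mul_of_pos_left _ (Int.natAbs_pos.mpr hk)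
    rcases Finset.mem_insert.mp hv with rfl | hv
    · have := h2 (n * N) ((le_max_right _ _).trans (hN.trans (hmul n hn)))
      rwa [show m * (n * N) = n * m * N by ring] at this
    · have := h1 (m * N) ((le_max_left _ _).trans (hN.trans (hmul m hm))) v hv
      rwa [show n * (m * N) = n * m * N by ring] at this

lemma axis_convex (Y : GTree G) {h : G} {u v x : Y.V} (hu : u ∈ Y.axis h) (hv : v ∈ Y.axis h)
    (hx : Y.graph.IsBtw u x v) : x ∈ Y.axis h := by
  classical
  obtain ⟨n, hn, h1⟩ := Y.axis_common {u, v} (by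
    intro w hw
    rcases Finset.mem_insert.mp hw with rfl | hw
    · exact hu
    · rwa [Finset.mem_singleton.mp hw])
  refine ⟨n, hn, fun y => ?_⟩
  obtain ⟨N₀, h2⟩ := h1 y
  exact ⟨N₀, fun N hN => Y.isTree.btw_of_btw_of_btw (h2 N hN u (by simp)) (h2 N hN v (by simp)) hx⟩

lemma axis_no_branch (Y : GTree G) {h : G} {v a b c : Y.V} (hv : v ∈ Y.axis h)
    (ha : a ∈ Y.axis h) (hb : b ∈ Y.axis h) (hc : c ∈ Y.axis h) (hab : a ≠ b) (hac : a ≠ c)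
    (hbc : b ≠ c) (va : Y.graph.Adj v a) (vb : Y.graph.Adj v b) (vc : Y.graph.Adj v c) : False := by
  classical
  obtain ⟨n, hn, h1⟩ := Y.axis_common {v, a, b, c} (by
    intro w hw
    simp only [Finset.mem_insert, Finset.mem_singleton] at hw
    rcases hw with rfl | rfl | rfl | rfl <;> assumption)
  obtain ⟨N, h2⟩ := h1 v
  have h3 := h2 N (by simp)
  have hv' := h3 v (by simp)
  have ha' := Y.isTree.eq_toward_of_btw hv' (h3 a (by simp)) va
  have hb' := Y.isTree.eq_toward_of_btw hv' (h3 b (by simp)) vb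
  have hc' := Y.isTree.eq_toward_of_btw hv' (h3 c (by simp)) vc
  rcases ha' with ha' | ha' <;> rcases hb' with hb' | hb' <;> rcases hc' with hc' | hc' <;>
    simp_all

lemma smul_mem_axis (Y : GTree G) {h g : G} {v : Y.V} (hv : v ∈ Y.axis h)
    (hg : ∃ a b : ℤ, a ≠ 0 ∧ b ≠ 0 ∧ h ^ a = g * h ^ b * g⁻¹) : Y.smul g v ∈ Y.axis h := by
  obtain ⟨a, b, ha, hb, hab⟩ := hg
  obtain ⟨n, hn, h1⟩ := hv
  refine ⟨a * n, mul_ne_zero ha hn, fun y => ?_⟩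
  obtain ⟨N₀, h2⟩ := h1 (Y.smul g⁻¹ y)
  refine ⟨N₀, fun N hN => ?_⟩
  have h3 := h2 (b * N) (hN.trans (by
    rw [Int.natAbs_mul]
    exact Nat.le_mul_of_pos_left _ (Int.natAbs_pos.mpr hb)))
  have key : ∀ k : ℤ, Y.smul (h ^ (a * k)) y = Y.smul g (Y.smul (h ^ (b * k)) (Y.smul g⁻¹ y)) := by
    intro k
    rw [zpow_mul, hab, conj_zpow, ← zpow_mul, Y.smul_mul, Y.smul_mul]
  rw [show -(a * n * N) = a * (-(n * N)) by ring, show a * n * N = a * (n * N) by ring, key, key,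
    btw_smul_iff, show b * (-(n * N)) = -(n * (b * N)) by ring,
    show b * (n * N) = n * (b * N) by ring]
  exact h3

lemma axis_subset (Y : GTree G) {h : G} {S : Set Y.V} (hS : Y.IsInvariantSubtree S) :
    Y.axis h ⊆ S := by
  rintro v ⟨n, -, h1⟩
  obtain ⟨⟨y, hy⟩, hinv, hconn⟩ := hS
  obtain ⟨N₀, h2⟩ := h1 y
  obtain ⟨W, hW⟩ := hconn _ (hinv (h ^ (-(n * N₀))) y hy) _ (hinv (h ^ (n * (N₀ : ℤ))) y hy)
  exact hW v (Y.isTree.mem_support_of_btw (h2 N₀ (by simp)) W)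

/-- Vertex stabilizers of a generalized Baumslag–Solitar tree are commensurable. -/
lemma IsGBSTree.exists_zpow_mem_stab {X : GTree G} (hX : X.IsGBSTree) {h : G} {x : X.V}
    (hx : h ∈ X.stab x) (v : X.V) : ∃ n : ℤ, n ≠ 0 ∧ h ^ n ∈ X.stab v := by
  obtain ⟨W⟩ := X.isTree.connected v x
  induction W with
  | nil => exact ⟨1, one_ne_zero, by simpa using hx⟩
  | @cons v w x hvw _ ih =>
    obtain ⟨n, hn, h1⟩ := ih hx
    obtain ⟨c, hc, hgen⟩ := exists_zpow_of_isCyclic (hX.1 w).1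
    obtain ⟨k, hk⟩ := hgen _ h1
    have hinf : ((X.stab v ⊓ X.stab w : Subgroup G) : Set G).Infinite :=
      Set.infinite_coe_iff.mp (hX.2 ⟨(v, w), hvw⟩).2
    obtain ⟨d, hd, hd1⟩ := hinf.exists_notMem_finite (Set.finite_singleton (1 : G))
    obtain ⟨j, rfl⟩ := hgen d hd.2
    have hj : j ≠ 0 := by
      rintro rfl
      simp at hd1
    refine ⟨n * j, mul_ne_zero hn hj, ?_⟩
    rw [zpow_mul, ← hk, ← zpow_mul, mul_comm, zpow_mul]
    exact Subgroup.zpow_mem _ hd.1 k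

/-- An element elliptic in a generalized Baumslag–Solitar tree is elliptic in every tree with
a nonlinear minimal subtree. -/
lemma exists_fixed_of_isGBSTree {X Y : GTree G} (hX : X.IsGBSTree)
    (hY : Y.HasNonlinearMinimalSubtree) {h : G} {x : X.V} (hx : h ∈ X.stab x) :
    ∃ y, Y.smul h y = y := by
  by_contra! hcon
  obtain ⟨y0, hb⟩ := Y.exists_btw_of_not_fixed hcon
  have hpow : ∀ n : ℤ, n ≠ 0 → h ^ n ≠ 1 := by
    intro n hn h1
    have h2 := Y.dist_zpow_smul (hcon y0) hb n
    rw [h1, Y.smul_one, SimpleGraph.dist_self] at h2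
    rcases Nat.mul_eq_zero.mp h2.symm with h3 | h3
    · exact hn (Int.natAbs_eq_zero.mp h3)
    · exact hcon y0 (Y.isTree.dist_eq_zero.mp h3).symm
  have hcomm : ∀ g, ∃ a b : ℤ, a ≠ 0 ∧ b ≠ 0 ∧ h ^ a = g * h ^ b * g⁻¹ := by
    intro g
    obtain ⟨n, hn, h1⟩ := hX.exists_zpow_mem_stab hx (X.smul g x)
    rw [mem_stab_smul] at h1
    obtain ⟨c, hc, hgen⟩ := exists_zpow_of_isCyclic (hX.1 x).1
    obtain ⟨k, hk⟩ := hgen _ h1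
    obtain ⟨l, rfl⟩ := hgen _ hx
    have hl : l ≠ 0 := by
      rintro rfl
      exact hpow 1 one_ne_zero (by simp)
    have hk0 : k ≠ 0 := by
      rintro rfl
      apply hpow n hn
      rw [zpow_zero] at hk
      calc (c ^ l) ^ n = g * (g⁻¹ * (c ^ l) ^ n * g) * g⁻¹ := by group
        _ = 1 := by rw [← hk]; group
    refine ⟨n * l, k, mul_ne_zero hn hl, hk0, ?_⟩
    have h2 : (c ^ l) ^ n = g * c ^ k * g⁻¹ := by
      rw [hk]
      group
    rw [zpow_mul, h2, conj_zpow, ← zpow_mul, ← zpow_mul, mul_comm l k]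
  obtain ⟨S, hS, hmin, v, hv, a, ha, b, hb', c, hc, hab, hac, hbc, va, vb, vc⟩ := hY
  have hA : Y.axis h = S := by
    refine hmin _ (Y.axis_subset hS) ⟨⟨y0, Y.mem_axis (hcon y0) hb⟩, ?_, ?_⟩
    · intro g v hv
      exact Y.smul_mem_axis hv (hcomm g)
    · intro u hu v hv
      obtain ⟨W, hW⟩ := Y.isTree.exists_walk_btw u v
      exact ⟨W, fun w hw => Y.axis_convex hu hv (hW w hw)⟩
  rw [← hA] at hv ha hb' hc
  exact Y.axis_no_branch hv ha hb' hc hab hac hbc va vb vc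

lemma fixesVertex_stab {X Y : GTree G} (hX : X.IsGBSTree) (hY : Y.HasNonlinearMinimalSubtree)
    (x : X.V) : Y.FixesVertex (X.stab x) := by
  obtain ⟨c, hc, hgen⟩ := exists_zpow_of_isCyclic (hX.1 x).1
  obtain ⟨y, hy⟩ := exists_fixed_of_isGBSTree hX hY hc
  refine ⟨y, fun g hg => ?_⟩
  obtain ⟨n, rfl⟩ := hgen g hg
  exact Subgroup.zpow_mem (Y.stab y) hy n

/-- A vertex stabilizer of a strongly slide-free tree does not fix a neighbouring vertex. -/
lemma StronglySlideFree.not_stab_le_of_adj {X : GTree G} (hX : X.StronglySlideFree) {a b : X.V}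
    (hab : X.graph.Adj a b) : ¬ X.stab a ≤ X.stab b := by
  intro hle
  obtain ⟨hmin, hssf⟩ := hX
  have huniq : ∀ c, X.graph.Adj a c → c = b := by
    intro c hac
    obtain ⟨γ, hγ⟩ := hssf ⟨(a, c), hac⟩ ⟨(a, b), hab⟩ rfl
      (inf_le_left.trans (le_inf le_rfl hle))
    have h1 : X.smul γ a = a := congrArg (fun e : X.Edge => e.1.1) hγ
    have h2 : X.smul γ c = b := congrArg (fun e : X.Edge => e.1.2) hγ
    exact X.smul_injective γ (h2.trans (hle h1 : X.smul γ b = b).symm)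
  have huniq' : ∀ g c, X.graph.Adj (X.smul g a) c → c = X.smul g b := by
    intro g c h
    rw [← X.smul_inv_smul g c, adj_smul_iff] at h
    rw [← huniq _ h, smul_inv_smul]
  by_cases hg : ∃ g, X.smul g a = b
  · obtain ⟨g, rfl⟩ := hg
    exact X.no_inversions g _ _ hab ⟨rfl, (huniq' g a hab.symm).symm⟩
  · have hS : X.IsInvariantSubtree {v | ∀ g, X.smul g a ≠ v} := by
      refine ⟨⟨b, fun g h => hg ⟨g, h⟩⟩, ?_, ?_⟩
      · intro γ x hx g h
        refine hx (γ⁻¹ * g) ?_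
        rw [X.smul_mul, h, inv_smul_smul]
      · intro x hx y hy
        obtain ⟨W, hW⟩ := X.isTree.exists_walk_btw x y
        refine ⟨W, ?_⟩
        rintro _ hv g rfl
        refine X.isTree.toward_ne_of_btw (hW _ hv) (hx g) (hy g) ?_
        rw [huniq' g _ (X.isTree.toward_spec (hx g)).1, huniq' g _ (X.isTree.toward_spec (hy g)).1]
    have := Set.eq_univ_iff_forall.mp (hmin _ hS) a
    exact this 1 (X.smul_one a)

lemma StronglySlideFree.eq_of_stab_le {X : GTree G} (hX : X.StronglySlideFree) {x x' : X.V}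
    (h : X.stab x ≤ X.stab x') : x = x' := by
  by_contra hne
  exact hX.not_stab_le_of_adj (X.isTree.toward_spec hne).1
    fun g hg => X.smul_toward_of_mem hg (h hg)

lemma StronglySlideFree.exists_smul_eq {X : GTree G} (hX : X.StronglySlideFree) {x u w : X.V}
    (hu : X.graph.Adj x u) (hw : X.graph.Adj x w)
    (h : ∀ g, g ∈ X.stab x → g ∈ X.stab u → g ∈ X.stab w) :
    ∃ γ ∈ X.stab x, X.smul γ u = w := by
  obtain ⟨γ, hγ⟩ := hX.2 ⟨(x, u), hu⟩ ⟨(x, w), hw⟩ rfl (fun g hg => ⟨hg.1, h g hg.1 hg.2⟩)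
  exact ⟨γ, congrArg (fun e : X.Edge => e.1.1) hγ, congrArg (fun e : X.Edge => e.1.2) hγ⟩

namespace IsContraction

variable {X Y : GTree G} {q : Y.V → X.V}

lemma stab_le (hq : IsContraction q) {g : G} {y : Y.V} (hg : g ∈ Y.stab y) :
    g ∈ X.stab (q y) := by
  rw [mem_stab, ← hq.map_smul, hg]

/-- The fibres of a contraction are convex. -/
lemma eq_of_btw (hq : IsContraction q) {u w v : Y.V} (h : q u = q v) (hw : Y.graph.IsBtw u w v) :
    q w = q u := by
  have hwalk : ∃ W : Y.graph.Walk u v, ∀ w ∈ W.support, q w = q u := by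
    have := hq.conn u v h
    clear h hw
    induction this with
    | rel a b h => exact ⟨Walk.cons h.1 Walk.nil, by simp [h.2]⟩
    | refl a => exact ⟨Walk.nil, by simp⟩
    | symm a b _ ih =>
      obtain ⟨W, hW⟩ := ih
      refine ⟨W.reverse, fun w hw => ?_⟩
      rw [Walk.support_reverse, List.mem_reverse] at hw
      rw [hW w hw, hW _ W.end_mem_support]
    | trans a b c _ _ ih1 ih2 =>
      obtain ⟨W, hW⟩ := ih1
      obtain ⟨W', hW'⟩ := ih2
      refine ⟨W.append W', fun w hw => ?_⟩
      rw [Walk.mem_support_append_iff] at hw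
      rcases hw with hw | hw
      · exact hW w hw
      · rw [hW' w hw, hW _ W.end_mem_support]
  obtain ⟨W, hW⟩ := hwalk
  exact hW w (Y.isTree.mem_support_of_btw hw W)

/-- An edge of the target of a contraction has only one preimage. -/
lemma edge_unique (hq : IsContraction q) {u v u' v' : Y.V} (h : Y.graph.Adj u v)
    (h' : Y.graph.Adj u' v') (hu : q u = q u') (hv : q v = q v') (hne : q u ≠ q v) :
    u = u' ∧ v = v' := by
  have key : ∀ {u v u' : Y.V}, Y.graph.Adj u v → q u = q u' → q u ≠ q v →
      Y.graph.dist v u' = Y.graph.dist u u' + 1 := by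
    intro u v u' h hu hne
    apply Y.isTree.dist_of_ne_toward h
    rintro rfl
    exact hne (hq.eq_of_btw hu (Y.isTree.btw_toward u u')).symm
  have h1 := key h hu hne
  have h2 := key h.symm hv hne.symm
  have h3 := key h'.symm hv.symm (by rw [← hu, ← hv]; exact hne.symm)
  rw [Y.graph.dist_comm, Y.graph.dist_comm (u := v')] at h3
  have huu : u = u' := by
    by_contra huu
    obtain ⟨t1, t2⟩ := Y.isTree.toward_spec huu
    have h4 : Y.graph.toward u v' = v := Y.isTree.eq_toward h h2
    have h5 := Y.isTree.dist_triangle (Y.graph.toward u u') u' v'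
    rw [dist_eq_one_iff_adj.mpr h'] at h5
    have h6 : Y.graph.toward u v' = Y.graph.toward u u' := by
      apply Y.isTree.eq_toward t1
      rcases Y.isTree.dist_adj v' t1 with h7 | h7 <;> omega
    refine hne (hq.eq_of_btw hu ?_).symm
    rw [← h4, h6]
    exact Y.isTree.btw_toward u u'
  refine ⟨huu, Y.isTree.dist_eq_zero.mp ?_⟩
  have := Y.isTree.dist_eq_zero.mpr huu
  omega

lemma id (X : GTree G) : IsContraction (X := X) (Y := X) id where
  map_smul _ _ := rfl
  map_adj _ _ h := Or.inr h
  surj := Function.surjective_id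
  ell y := ⟨y, fun _ hg => hg⟩
  conn u v h := by
    change u = v at h
    rw [h]
    exact Relation.EqvGen.refl _

end IsContraction

lemma IsCollapse.eqvGen {Y Y₁ : GTree G} {φ : Y.V → Y₁.V} {e : Y.Edge} (h : IsCollapse Y Y₁ φ e)
    {u v : Y.V} (huv : φ u = φ v) :
    Relation.EqvGen (fun a b => Y.graph.Adj a b ∧ φ a = φ b) u v := by
  obtain ⟨-, -, -, -, h5, -⟩ := h
  refine ((h5 u v).mp huv).mono fun a b hab => ⟨?_, ?_⟩
  · obtain ⟨γ, rfl, rfl⟩ := hab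
    exact Y.smul_adj γ e.2
  · exact (h5 a b).mpr (Relation.EqvGen.rel _ _ hab)

lemma IsCollapse.map_adj {Y Y₁ : GTree G} {φ : Y.V → Y₁.V} {e : Y.Edge} (h : IsCollapse Y Y₁ φ e)
    {u v : Y.V} (huv : Y.graph.Adj u v) : φ u = φ v ∨ Y₁.graph.Adj (φ u) (φ v) := by
  by_cases hne : φ u = φ v
  · exact Or.inl hne
  · exact Or.inr ((h.2.2.2.2.2 _ _ hne).mpr ⟨u, v, huv, rfl, rfl⟩)

lemma IsCollapse.stab_le {Y Y₁ : GTree G} {φ : Y.V → Y₁.V} {e : Y.Edge} (h : IsCollapse Y Y₁ φ e) :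
    Y.stab (d0 e) ≤ Y.stab (d1 e) := inf_eq_left.mp h.1

open Classical in
lemma IsCollapse.isContraction {Y Y₁ : GTree G} {φ : Y.V → Y₁.V} {e : Y.Edge}
    (h : IsCollapse Y Y₁ φ e) : IsContraction (X := Y) (Y := Y₁) φ := by
  have hst := h.stab_le
  have hconn : ∀ {u v}, φ u = φ v → _ := h.eqvGen
  have hadj : ∀ {u v}, Y.graph.Adj u v → _ := h.map_adj
  obtain ⟨-, h2, h3, h4, h5, h6⟩ := h
  refine ⟨⟨h4, fun _ _ => hadj, h3, ?_⟩, fun _ _ => hconn⟩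
  set a := d0 e
  set b := d1 e
  let r : Y.V → Y.V := fun v => if hv : ∃ γ, Y.smul γ a = v then Y.smul hv.choose b else v
  have hra : ∀ γ, r (Y.smul γ a) = Y.smul γ b := by
    intro γ
    have hv : ∃ δ, Y.smul δ a = Y.smul γ a := ⟨γ, rfl⟩
    simp only [r, dif_pos hv]
    have h7 : γ⁻¹ * hv.choose ∈ Y.stab a := by
      rw [mem_stab, Y.smul_mul, hv.choose_spec, inv_smul_smul]
    have h8 := hst h7
    rw [mem_stab, Y.smul_mul, Y.smul_eq_iff, inv_inv] at h8
    exact h8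
  have hrb : ∀ v, (¬ ∃ γ, Y.smul γ a = v) → r v = v := fun v hv => dif_neg hv
  have hrs : ∀ g v, r (Y.smul g v) = Y.smul g (r v) := by
    intro g v
    by_cases hv : ∃ γ, Y.smul γ a = v
    · obtain ⟨γ, rfl⟩ := hv
      rw [← Y.smul_mul, hra, hra, Y.smul_mul]
    · rw [hrb v hv, hrb]
      rintro ⟨γ, hγ⟩
      exact hv ⟨g⁻¹ * γ, by rw [Y.smul_mul, hγ, inv_smul_smul]⟩
  have hrφ : ∀ u v, φ u = φ v → r u = r v := by
    intro u v huv
    have := (h5 u v).mp huv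
    clear huv
    induction this with
    | rel _ _ h =>
      obtain ⟨γ, rfl, rfl⟩ := h
      rw [hra, hrb]
      rintro ⟨δ, hδ⟩
      apply h2 (γ⁻¹ * δ)
      rw [Y.smul_mul, hδ, inv_smul_smul]
    | refl => rfl
    | symm _ _ _ ih => exact ih.symm
    | trans _ _ _ _ _ ih1 ih2 => exact ih1.trans ih2
  intro y
  obtain ⟨u, rfl⟩ := h3 y
  refine ⟨r u, fun g hg => ?_⟩
  rw [← hrs]
  apply hrφ
  rw [h4, hg]

/-- Contractions onto `X` can be pulled back along expansions. -/
lemma IsCollapse.comp_isContraction {X Y Y₁ : GTree G} {φ : Y.V → Y₁.V} {e : Y.Edge}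
    (h : IsCollapse Y Y₁ φ e) {q : Y₁.V → X.V} (hq : IsContraction q) :
    IsContraction (X := Y) (Y := X) (q ∘ φ) where
  map_smul g x := by simp [h.isContraction.map_smul, hq.map_smul]
  map_adj u v huv := by
    rcases h.map_adj huv with h1 | h1
    · exact Or.inl (congrArg q h1)
    · exact hq.map_adj _ _ h1
  surj := hq.surj.comp h.isContraction.surj
  ell x := by
    obtain ⟨y, hy⟩ := hq.ell x
    obtain ⟨z, hz⟩ := h.isContraction.ell y
    exact ⟨z, fun g hg => hz g (hy g hg)⟩
  conn := by
    have hfib : ∀ {u v}, φ u = φ v →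
        Relation.EqvGen (fun a b => Y.graph.Adj a b ∧ (q ∘ φ) a = (q ∘ φ) b) u v := fun huv =>
      (h.eqvGen huv).mono fun a b hab => ⟨hab.1, congrArg q hab.2⟩
    have key : ∀ y y', Relation.EqvGen (fun a b => Y₁.graph.Adj a b ∧ q a = q b) y y' →
        ∀ u v, φ u = y → φ v = y' →
        Relation.EqvGen (fun a b => Y.graph.Adj a b ∧ (q ∘ φ) a = (q ∘ φ) b) u v := by
      intro y y' hyy
      induction hyy with
      | rel y y' hyy =>
        rintro u v rfl rfl
        obtain ⟨u', v', h1, h2, h3⟩ := (h.2.2.2.2.2 _ _ hyy.1.ne).mp hyy.1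
        refine (hfib h2.symm).trans _ _ _ (Relation.EqvGen.trans _ _ _
          (Relation.EqvGen.rel _ _ ⟨h1, ?_⟩) (hfib h3))
        simp only [Function.comp, h2, h3, hyy.2]
      | refl y =>
        rintro u v rfl h2
        exact hfib h2.symm
      | symm _ _ _ ih =>
        intro u v h1 h2
        exact (ih v u h2 h1).symm
      | trans _ y _ _ _ ih1 ih2 =>
        intro u v h1 h2
        obtain ⟨w, hw⟩ := h.isContraction.surj y
        exact (ih1 u w h1 hw).trans _ _ _ (ih2 w v hw h2)
    intro u v huv
    exact key _ _ (hq.conn _ _ huv) u v rfl rfl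

/-- A contraction identifying the ends of a collapsed edge factors through the collapse. -/
lemma IsCollapse.exists_isContraction {X Y Y₁ : GTree G} {φ : Y.V → Y₁.V} {e : Y.Edge}
    (h : IsCollapse Y Y₁ φ e) {q : Y.V → X.V} (hq : IsContraction q)
    (he : q (d0 e) = q (d1 e)) : ∃ q₁ : Y₁.V → X.V, IsContraction q₁ := by
  have hadj : ∀ {u v}, Y.graph.Adj u v → _ := h.map_adj
  obtain ⟨-, -, h3, h4, h5, h6⟩ := h
  have hfac : ∀ u v, φ u = φ v → q u = q v := by
    intro u v huv
    have := (h5 u v).mp huv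
    clear huv
    induction this with
    | rel _ _ h =>
      obtain ⟨γ, rfl, rfl⟩ := h
      rw [hq.map_smul, hq.map_smul, he]
    | refl => rfl
    | symm _ _ _ ih => exact ih.symm
    | trans _ _ _ _ _ ih1 ih2 => exact ih1.trans ih2
  obtain ⟨q₁, hq₁⟩ : ∃ q₁ : Y₁.V → X.V, ∀ u, q₁ (φ u) = q u :=
    ⟨fun y => q (Function.surjInv h3 y), fun u => hfac _ _ (Function.surjInv_eq h3 _)⟩
  refine ⟨q₁, ⟨?_, ?_, ?_, ?_⟩, ?_⟩
  · intro g y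
    obtain ⟨u, rfl⟩ := h3 y
    rw [← h4, hq₁, hq₁, hq.map_smul]
  · intro y y' hyy
    obtain ⟨u, v, huv, rfl, rfl⟩ := (h6 _ _ hyy.ne).mp hyy
    rw [hq₁, hq₁]
    exact hq.map_adj u v huv
  · intro x
    obtain ⟨u, rfl⟩ := hq.surj x
    exact ⟨φ u, hq₁ u⟩
  · intro x
    obtain ⟨p, hp⟩ := hq.ell x
    exact ⟨φ p, fun g hg => by rw [← h4, hp g hg]⟩
  · intro y y' hyy
    obtain ⟨u, rfl⟩ := h3 y
    obtain ⟨v, rfl⟩ := h3 y'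
    rw [hq₁, hq₁] at hyy
    have := hq.conn u v hyy
    clear hyy
    induction this with
    | rel a b hab =>
      rcases hadj hab.1 with h7 | h7
      · rw [h7]
        exact Relation.EqvGen.refl _
      · exact Relation.EqvGen.rel _ _ ⟨h7, by rw [hq₁, hq₁, hab.2]⟩
    | refl => exact Relation.EqvGen.refl _
    | symm _ _ _ ih => exact ih.symm
    | trans _ _ _ _ _ ih1 ih2 => exact ih1.trans _ _ _ ih2

end GTree

namespace SimpleGraph.IsTree

variable {V : Type*} {T : SimpleGraph V}

/-- A geodesic has only one point at a given distance from its origin. -/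
lemma eq_of_btw_of_dist_eq (hT : T.IsTree) {u v x y : V} (hx : T.IsBtw u x v) (hy : T.IsBtw u y v)
    (hd : T.dist u x = T.dist u y) : x = y := by
  obtain ⟨n, hn⟩ : ∃ n, T.dist u x = n := ⟨_, rfl⟩
  induction n generalizing u with
  | zero =>
    rw [← hT.dist_eq_zero.mp hn, hT.dist_eq_zero.mp (hd.symm.trans hn)]
  | succ n ih =>
    have hux : u ≠ x := by
      rintro rfl
      simp at hn
    have huy : u ≠ y := by
      rintro rfl
      simp [hn] at hd
    have h1 := hT.toward_eq_of_btw hx hux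
    have h2 := hT.toward_eq_of_btw hy huy
    obtain ⟨h3, h4⟩ := hT.toward_spec hux
    obtain ⟨-, h5⟩ := hT.toward_spec huy
    have huv : u ≠ v := by
      rintro rfl
      have := hT.dist_pos hux
      simp only [IsBtw, dist_self] at hx
      omega
    obtain ⟨-, h6⟩ := hT.toward_spec huv
    rw [← h2, h1] at h5
    rw [h1] at h6
    unfold IsBtw at hx hy
    refine @ih (T.toward u x) ?_ ?_ ?_ ?_ <;> (try unfold IsBtw) <;> omega

end SimpleGraph.IsTree

namespace GTree

open SimpleGraph

variable {G : Type u} [Group G]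

open Classical in
/-- A contraction onto a strongly slide-free tree can be changed by a slide so as to identify the
ends of a given collapsible edge. -/
lemma IsContraction.exists_slide {X Y : GTree G} (hX : X.StronglySlideFree) {q : Y.V → X.V}
    (hq : IsContraction q) {a b : Y.V} (hab : Y.graph.Adj a b) (hst : Y.stab a ≤ Y.stab b)
    (horb : ∀ g, Y.smul g a ≠ b) (hne : q a ≠ q b) :
    ∃ q' : Y.V → X.V, IsContraction q' ∧ q' a = q' b := by
  obtain ⟨x, hx⟩ : ∃ x, q a = x := ⟨_, rfl⟩
  obtain ⟨x', hx'⟩ : ∃ x', q b = x' := ⟨_, rfl⟩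
  rw [hx, hx'] at hne
  have hxx : X.graph.Adj x x' := by
    rcases hq.map_adj _ _ hab with h | h
    · rw [hx, hx'] at h; exact absurd h hne
    · rwa [hx, hx'] at h
  have hbx : ∀ g, g ∈ Y.stab a → g ∈ X.stab x' := fun g hg => hx' ▸ hq.stab_le (hst hg)
  have hfix : ¬ ∀ g ∈ X.stab x, g ∈ Y.stab a := fun h =>
    hne (hX.eq_of_stab_le fun g hg => hbx g (h g hg))
  have hqfix : ∀ {y z}, (∀ g ∈ X.stab y, Y.smul g z = z) → q z = y := fun h =>
    (hX.eq_of_stab_le fun g hg => hq.stab_le (h g hg)).symm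
  obtain ⟨p, hp⟩ := hq.ell x
  have hqp : q p = x := hqfix hp
  let B : Set Y.V := {v | q v = x ∧ Y.graph.IsBtw v a p}
  have haB : a ∈ B := ⟨hx, by simp [IsBtw]⟩
  have hstick : ∀ {v w}, v ∈ B → Y.graph.Adj v w → q w ≠ x → v = a ∧ w = b := by
    rintro v w ⟨hv, hbtw⟩ hvw hw
    have hxw : X.graph.Adj x (q w) := by
      rcases hq.map_adj _ _ hvw with h | h
      · exact absurd (h.symm.trans hv) hw
      · rwa [hv] at h
    obtain ⟨γ, hγ, hγw⟩ := hX.exists_smul_eq hxw hxx fun g h1 h2 => by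
      have h3 := (hq.edge_unique (Y.smul_adj g hvw) hvw (by rw [hq.map_smul, hv]; exact h1)
        (by rw [hq.map_smul]; exact h2) (by
          rw [hq.map_smul, hq.map_smul, hv]
          exact fun h => hxw.ne (X.smul_injective g h))).1
      exact hbx g (Y.mem_stab_of_btw h3 (hp g h1) hbtw)
    obtain ⟨h4, h5⟩ := hq.edge_unique (Y.smul_adj γ hvw) hab
      (by rw [hq.map_smul, hv, hx]; exact hγ) (by rw [hq.map_smul, hγw, hx'])
      (by rw [hq.map_smul, hq.map_smul, hv]
          exact fun h => hxw.ne (X.smul_injective γ h))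
    have h6 : Y.graph.dist a p = Y.graph.dist v p := by
      rw [← Y.dist_smul γ v p, h4, hp γ hγ]
    have hva : v = a := by
      apply Y.isTree.dist_eq_zero.mp
      unfold IsBtw at hbtw
      omega
    subst hva
    exact ⟨rfl, Y.smul_injective γ (h5.trans (hst h4 : Y.smul γ b = b).symm)⟩
  have hwd : ∀ {k w w'}, w ∈ B → w' ∈ B → Y.smul k w' = w → X.smul k x' = x' := by
    rintro k w w' ⟨h1, h2⟩ ⟨h3, h4⟩ rfl
    rw [hq.map_smul, h3] at h1
    have h5 := (Y.btw_smul_iff k w' a p).mpr h4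
    rw [hp k h1] at h5
    refine hbx k (Y.isTree.eq_of_btw_of_dist_eq h5 h2 ?_)
    have h6 : Y.graph.dist (Y.smul k a) p = Y.graph.dist a p := by
      rw [← Y.dist_smul k a p, hp k h1]
    unfold IsBtw at h5 h2
    omega
  have hb : ∀ g w, w ∈ B → Y.smul g w ≠ b := by
    intro g w hw hgw
    have h1 : Y.graph.Adj w (Y.smul g⁻¹ a) := by
      rw [← Y.adj_smul_iff g, hgw, Y.smul_inv_smul]
      exact hab.symm
    have h2 := hstick hw h1 (by
      rw [hq.map_smul, hx]
      intro h
      rw [← hw.1] at h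
      have h3 := congrArg (X.smul g) h
      rw [X.smul_inv_smul, ← hq.map_smul, hgw, hx'] at h3
      rw [hw.1] at h3
      exact hne h3)
    exact horb g (h2.1 ▸ hgw)
  have hL : ∀ {u v}, u ∈ B → Y.graph.Adj u v → q v = x → v ∉ B → u = a ∧ v = Y.graph.toward a p := by
    rintro u v ⟨hu, hbtw⟩ huv hv hvB
    have hnb : ¬ Y.graph.IsBtw v a p := fun h => hvB ⟨hv, h⟩
    unfold IsBtw at hbtw hnb
    by_cases hua : u = a
    · subst hua
      refine ⟨rfl, ?_⟩
      by_contra h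
      have h1 := Y.isTree.dist_of_ne_toward huv (Ne.symm h)
      rw [dist_eq_one_iff_adj.mpr huv.symm] at hnb
      omega
    · exfalso
      have ht := Y.isTree.toward_eq_of_btw hbtw hua
      rcases Y.isTree.dist_adj a huv with h1 | h1
      · have h2 := Y.isTree.eq_toward huv h1
        have hup : u ≠ p := by
          rintro rfl
          have := Y.isTree.dist_pos hua
          rw [dist_self] at hbtw
          omega
        obtain ⟨-, h3⟩ := Y.isTree.toward_spec hup
        rw [ht, h2] at h3
        omega
      · have h2 : Y.graph.toward u a ≠ v := by
          rintro rfl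
          have := (Y.isTree.toward_spec hua).2
          omega
        have h3 := Y.isTree.dist_of_ne_toward huv (ht ▸ h2)
        omega
  let q' : Y.V → X.V := fun v =>
    if h : ∃ g : G, ∃ w ∈ B, Y.smul g w = v then X.smul h.choose x' else q v
  have hq1 : ∀ g w, w ∈ B → q' (Y.smul g w) = X.smul g x' := by
    intro g w hw
    have h : ∃ g' : G, ∃ w' ∈ B, Y.smul g' w' = Y.smul g w := ⟨g, w, hw, rfl⟩
    simp only [q', dif_pos h]
    obtain ⟨w', hw', h1⟩ := h.choose_spec
    have h2 := hwd (k := g⁻¹ * h.choose) hw hw' (by rw [Y.smul_mul, h1, inv_smul_smul])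
    rw [X.smul_mul, X.smul_eq_iff, inv_inv] at h2
    exact h2
  have hq1' : ∀ w ∈ B, q' w = x' := fun w hw => by
    have := hq1 1 w hw
    rwa [Y.smul_one, X.smul_one] at this
  have hq2 : ∀ v, (¬ ∃ g : G, ∃ w ∈ B, Y.smul g w = v) → q' v = q v := fun v hv => dif_neg hv
  have hU : ∀ g v, (∃ k : G, ∃ w ∈ B, Y.smul k w = Y.smul g v) → ∃ k : G, ∃ w ∈ B, Y.smul k w = v := by
    rintro g v ⟨k, w, hw, h⟩
    exact ⟨g⁻¹ * k, w, hw, by rw [Y.smul_mul, h, inv_smul_smul]⟩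
  have hbU : ¬ ∃ g : G, ∃ w ∈ B, Y.smul g w = b := fun ⟨g, w, hw, h⟩ => hb g w hw h
  have hsm : ∀ g v, q' (Y.smul g v) = X.smul g (q' v) := by
    intro g v
    by_cases hv : ∃ k : G, ∃ w ∈ B, Y.smul k w = v
    · obtain ⟨k, w, hw, rfl⟩ := hv
      rw [← Y.smul_mul, hq1 _ _ hw, hq1 _ _ hw, X.smul_mul]
    · rw [hq2 v hv, hq2 _ fun h => hv (hU g v h), hq.map_smul]
  have hadjB : ∀ w ∈ B, ∀ v, Y.graph.Adj w v → q' w = q' v ∨ X.graph.Adj (q' w) (q' v) := by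
    intro w hw v hwv
    rw [hq1' w hw]
    by_cases hqv : q v = x
    · by_cases hvU : ∃ k : G, ∃ w' ∈ B, Y.smul k w' = v
      · by_cases hvB : v ∈ B
        · exact Or.inl (hq1' v hvB).symm
        · obtain ⟨k, w', hw', rfl⟩ := hvU
          exfalso
          obtain ⟨rfl, h2⟩ := hL hw hwv hqv hvB
          rw [hq.map_smul, hw'.1] at hqv
          have h3 : Y.graph.dist (Y.smul k w') p = Y.graph.dist w' p := by
            rw [← Y.dist_smul k w' p, hp k hqv]
          have h4 := hw'.2
          unfold IsBtw at h4
          have hap : w ≠ p := by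
            rintro rfl
            exact hfix hp
          have h5 := (Y.isTree.toward_spec hap).2
          rw [← h2] at h5
          omega
      · rw [hq2 v hvU, hqv]
        exact Or.inr hxx.symm
    · obtain ⟨-, rfl⟩ := hstick hw hwv hqv
      rw [hq2 _ hbU, hx']
      exact Or.inl rfl
  have hadjU : ∀ u, (∃ k : G, ∃ w ∈ B, Y.smul k w = u) → ∀ v, Y.graph.Adj u v →
      q' u = q' v ∨ X.graph.Adj (q' u) (q' v) := by
    rintro _ ⟨k, w, hw, rfl⟩ v h
    rw [← Y.smul_inv_smul k v, adj_smul_iff] at h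
    have h1 := hadjB w hw _ h
    rw [hsm] at h1 ⊢
    rcases h1 with h1 | h1
    · left
      rw [h1, X.smul_inv_smul]
    · right
      rw [← X.smul_inv_smul k (q' v), adj_smul_iff]
      exact h1
  have hp1 : ∀ {x₁ p₁}, (∀ g ∈ X.stab x₁, Y.smul g p₁ = p₁) →
      ¬ ∃ g : G, ∃ w ∈ B, Y.smul g w = p₁ := by
    rintro x₁ p₁ h ⟨g, w, hw, rfl⟩
    have h1 := hqfix h
    rw [hq.map_smul, hw.1] at h1
    subst h1
    refine hfix fun k hk => Y.mem_stab_of_btw ?_ (hp k hk) hw.2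
    have h2 := h (g * k * g⁻¹) (by
      rw [mem_stab, X.smul_mul, X.smul_mul, inv_smul_smul, hk])
    rw [Y.smul_mul, Y.smul_mul, inv_smul_smul] at h2
    exact Y.smul_injective g h2
  let E := Relation.EqvGen fun u v => Y.graph.Adj u v ∧ q' u = q' v
  have hA : ∀ {x₁ p₁}, (∀ g ∈ X.stab x₁, Y.smul g p₁ = p₁) → ∀ n v, Y.graph.dist v p₁ = n →
      q v = x₁ → (¬ ∃ g : G, ∃ w ∈ B, Y.smul g w = v) → E v p₁ := by
    intro x₁ p₁ h n
    induction n with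
    | zero =>
      intro v hv _ _
      rw [Y.isTree.dist_eq_zero.mp hv]
      exact Relation.EqvGen.refl _
    | succ n ih =>
      intro v hv hqv hvU
      have hvp : v ≠ p₁ := by
        rintro rfl
        simp at hv
      obtain ⟨h1, h2⟩ := Y.isTree.toward_spec hvp
      have h3 := hq.eq_of_btw (hqv.trans (hqfix h).symm) (Y.isTree.btw_toward v p₁)
      have h4 : ¬ ∃ g : G, ∃ w ∈ B, Y.smul g w = Y.graph.toward v p₁ := by
        rintro ⟨g, w, hw, h5⟩
        have h6 : Y.graph.Adj w (Y.smul g⁻¹ v) := by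
          rw [← Y.adj_smul_iff g, h5, Y.smul_inv_smul]
          exact h1.symm
        have h7 : X.smul g x = x₁ := by
          rw [← hw.1, ← hq.map_smul, h5, h3, hqv]
        have h8 : ¬ ∃ k : G, ∃ w ∈ B, Y.smul k w = Y.smul g⁻¹ v := fun h => hvU (hU _ _ h)
        obtain ⟨rfl, h9⟩ := hL hw h6 (by rw [hq.map_smul, hqv, ← h7, inv_smul_smul])
          fun h => h8 ⟨1, _, h, Y.smul_one _⟩
        have h10 : Y.graph.dist (Y.smul g⁻¹ v) (Y.smul g⁻¹ p₁) =
            Y.graph.dist w (Y.smul g⁻¹ p₁) + 1 := by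
          rw [dist_smul, h2, ← h5, ← Y.dist_smul g w, Y.smul_inv_smul]
        have h11 : Y.graph.IsBtw p w (Y.smul g⁻¹ p₁) := by
          apply Y.isTree.btw_of_toward_ne
          rw [← h9]
          intro h12
          by_cases h13 : w = Y.smul g⁻¹ p₁
          · rw [← h13, IsTree.toward_self] at h12
            exact h6.ne h12.symm
          · have := (Y.isTree.toward_spec h13).2
            rw [← h12] at this
            omega
        refine hfix fun k hk => Y.mem_stab_of_btw (hp k hk) ?_ h11
        have h14 := h (g * k * g⁻¹) (by
          rw [mem_stab, ← h7, X.smul_mul, X.smul_mul, inv_smul_smul, hk])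
        rw [Y.smul_mul, Y.smul_mul, Y.smul_eq_iff] at h14
        exact h14
      refine Relation.EqvGen.trans _ _ _ (Relation.EqvGen.rel _ _ ⟨h1, ?_⟩)
        (ih (Y.graph.toward v p₁) (by omega) (h3.trans hqv) h4)
      rw [hq2 v hvU, hq2 _ h4, h3]
  have hB : ∀ g n w, w ∈ B → Y.graph.dist w a = n → E (Y.smul g w) (Y.smul g a) := by
    intro g n
    induction n with
    | zero =>
      intro w _ hn
      rw [Y.isTree.dist_eq_zero.mp hn]
      exact Relation.EqvGen.refl _
    | succ n ih =>
      intro w hw hn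
      have hwa : w ≠ a := by
        rintro rfl
        simp at hn
      obtain ⟨h1, h2⟩ := Y.isTree.toward_spec hwa
      have h3 : Y.graph.toward w a ∈ B := by
        refine ⟨(hq.eq_of_btw (hw.1.trans hx.symm) (Y.isTree.btw_toward w a)).trans hw.1, ?_⟩
        have h4 := hw.2
        have h5 := Y.isTree.dist_triangle w (Y.graph.toward w a) p
        have h6 := Y.isTree.dist_triangle (Y.graph.toward w a) a p
        rw [dist_eq_one_iff_adj.mpr h1] at h5
        unfold IsBtw at *
        omega
      exact Relation.EqvGen.trans _ _ _
        (Relation.EqvGen.rel _ _ ⟨Y.smul_adj g h1, by rw [hq1 g w hw, hq1 g _ h3]⟩)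
        (ih _ h3 (by omega))
  refine ⟨q', ⟨⟨hsm, ?_, ?_, hq.ell⟩, ?_⟩, ?_⟩
  · intro u v huv
    by_cases hu : ∃ k : G, ∃ w ∈ B, Y.smul k w = u
    · exact hadjU u hu v huv
    by_cases hv : ∃ k : G, ∃ w ∈ B, Y.smul k w = v
    · exact (hadjU v hv u huv.symm).imp Eq.symm fun h => h.symm
    rw [hq2 u hu, hq2 v hv]
    exact hq.map_adj u v huv
  · intro x₁
    obtain ⟨p₁, h⟩ := hq.ell x₁
    exact ⟨p₁, (hq2 _ (hp1 h)).trans (hqfix h)⟩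
  · have key : ∀ {x₁ p₁}, (∀ g ∈ X.stab x₁, Y.smul g p₁ = p₁) → ∀ v, q' v = x₁ → E v p₁ := by
      intro x₁ p₁ h v hv
      by_cases hvU : ∃ k : G, ∃ w ∈ B, Y.smul k w = v
      · obtain ⟨g, w, hw, rfl⟩ := hvU
        rw [hq1 g w hw] at hv
        have h1 : ¬ ∃ k : G, ∃ w ∈ B, Y.smul k w = Y.smul g b := fun h => hbU (hU _ _ h)
        have h2 : q (Y.smul g b) = x₁ := by rw [hq.map_smul, hx', hv]
        refine Relation.EqvGen.trans _ _ _ (hB g _ w hw rfl) (Relation.EqvGen.trans _ _ _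
          (Relation.EqvGen.rel _ _ ⟨Y.smul_adj g hab, ?_⟩) (hA h _ _ rfl h2 h1))
        rw [hq1 g a haB, hq2 _ h1, h2, hv]
      · exact hA h _ _ rfl ((hq2 v hvU).symm.trans hv) hvU
    intro u v huv
    obtain ⟨p₁, h⟩ := hq.ell (q' v)
    exact Relation.EqvGen.trans _ _ _ (key h u huv) (Relation.EqvGen.symm _ _ (key h v rfl))
  · rw [hq1' a haB, hq2 b hbU, hx']

/-- A tree has a contraction onto a strongly slide-free tree if and only if its collapses do. -/
lemma Collapse.exists_isContraction_iff {X Y Y₁ : GTree G} (hX : X.StronglySlideFree)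
    (h : Collapse Y Y₁) :
    (∃ q : Y.V → X.V, IsContraction q) ↔ ∃ q : Y₁.V → X.V, IsContraction q := by
  obtain ⟨φ, e, h⟩ := h
  constructor
  · rintro ⟨q, hq⟩
    by_cases hne : q (d0 e) = q (d1 e)
    · exact h.exists_isContraction hq hne
    · obtain ⟨q', hq', he⟩ := hq.exists_slide hX e.2 h.stab_le h.2.1 hne
      exact h.exists_isContraction hq' he
  · rintro ⟨q, hq⟩
    exact ⟨_, h.comp_isContraction hq⟩

lemma ElemDeformation.exists_isContraction_iff {X Y Z : GTree G} (hX : X.StronglySlideFree)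
    (h : ElemDeformation Y Z) :
    (∃ q : Y.V → X.V, IsContraction q) ↔ ∃ q : Z.V → X.V, IsContraction q := by
  induction h with
  | rel _ _ h => exact h.exists_isContraction_iff hX
  | refl => rfl
  | symm _ _ _ ih => exact ih.symm
  | trans _ _ _ _ _ ih1 ih2 => exact ih1.trans ih2

lemma IsContraction.isGIso_of_reduced {X Z : GTree G} {q : Z.V → X.V} (hq : IsContraction q)
    (hZ : Z.Reduced) : IsGIso Z X q := by
  refine IsEllMap.isGIso hq.toIsEllMap (hq.injective fun u v huv h => ?_)
  obtain ⟨a, b, hab, -, hle, horb⟩ := exists_collapsible hq.toIsEllMap huv h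
  obtain ⟨g, hg⟩ := hZ ⟨(a, b), hab⟩ (inf_eq_left.mpr hle)
  exact horb g hg

lemma StronglySlideFree.isGIso_unique {X Y : GTree G} (hX : X.StronglySlideFree)
    {φ φ' : X.V → Y.V} (h : IsGIso X Y φ) (h' : IsGIso X Y φ') : φ = φ' := by
  obtain ⟨ψ, hψ, -, hφψ⟩ := h.symm
  funext x
  have : x = ψ (φ' x) := hX.eq_of_stab_le fun g hg => by
    rw [mem_stab] at hg
    rw [mem_stab, ← hψ.2.2, ← h'.2.2, hg]
  rw [← hφψ (φ' x), ← this]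

lemma ElemDeformation.exists_isGIso {X Y : GTree G} (hX : X.StronglySlideFree)
    (h : ElemDeformation X Y) {Z : GTree G} (hYZ : Relation.ReflTransGen Collapse Y Z)
    (hZ : Z.Reduced) : ∃ φ : Z.V → X.V, IsGIso Z X φ := by
  have hXZ : ElemDeformation X Z :=
    Relation.EqvGen.trans _ _ _ h (Relation.EqvGen.reflTransGen_le_eqvGen _ _ _ hYZ)
  obtain ⟨q, hq⟩ := (hXZ.exists_isContraction_iff hX).mp ⟨_, IsContraction.id X⟩
  exact ⟨q, hq.isGIso_of_reduced hZ⟩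

end GTree

open GTree in
/-- Corollary 6.10: let `X` and `Y` be cocompact generalized Baumslag–Solitar
trees with group `G`, each having a minimal subtree not contained in a line.
Then: (1) there is an elementary deformation relating `X` to `Y`; (2) if `X`
is strongly slide-free, then `Y` is uniquely reducible to `X` (every maximal
sequence of collapse moves performed on `Y` ends at a `G`-tree isomorphic to
`X`); and (3) if in addition `Y` is reduced, then there is a unique
isomorphism of `G`-trees `X → Y`. -/
theorem gbs_rigidity {G : Type u} [Group G] (X Y : GTree G)
    (hXc : X.Cocompact) (hYc : Y.Cocompact)
    (hXgbs : X.IsGBSTree) (hYgbs : Y.IsGBSTree)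
    (hXm : X.HasNonlinearMinimalSubtree) (hYm : Y.HasNonlinearMinimalSubtree) :
    ElemDeformation X Y ∧
    (X.StronglySlideFree →
      ∀ Z : GTree G, Relation.ReflTransGen Collapse Y Z → Z.Reduced →
        ∃ φ : Z.V → X.V, IsGIso Z X φ) ∧
    (X.StronglySlideFree → Y.Reduced → ∃! φ : X.V → Y.V, IsGIso X Y φ) := by
  have hdef : ElemDeformation X Y := elemDeformation_of_stab hXc hYc hXgbs hYgbs
    (fun y => fixesVertex_stab hYgbs hXm y) fun x => fixesVertex_stab hXgbs hYm x
  refine ⟨hdef, fun hX Z hYZ hZ => hdef.exists_isGIso hX hYZ hZ, fun hX hY => ?_⟩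
  obtain ⟨q, hq⟩ := hdef.exists_isGIso hX .refl hY
  obtain ⟨φ, hφ, -⟩ := hq.symm
  exact ⟨φ, hφ, fun φ' h' => hX.isGIso_unique h' hφ⟩
end

section
/- Let G be a group and X a proper G-tree. If φ : V(X) → V(X) is an L-equivariant map, then d(x, φ(x)) < L/2 for every vertex x; in particular, if φ is equivariant (L-equivariant for every L > 0, i.e., φ(γx) = γφ(x)), then φ is the identity map. -/
universe u

/-- In a tree, two paths issuing from a common vertex along different edges form a geodesic. -/
theorem SimpleGraph.IsTree.dist_eq_of_isPath_cons {V : Type*} {T : SimpleGraph V} (hT : T.IsTree)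
    {x a b y z : V} (ha : T.Adj x a) (hb : T.Adj x b) (hab : a ≠ b) {p : T.Walk a y}
    {q : T.Walk b z} (hp : (p.cons ha).IsPath) (hq : (q.cons hb).IsPath) :
    T.dist y z = (p.cons ha).length + (q.cons hb).length := by
  have hr : ((p.cons ha).reverse.append (q.cons hb)).IsPath := by
    rw [hT.isAcyclic.isPath_iff_isChain, SimpleGraph.Walk.edges_append, List.isChain_append]
    refine ⟨(hT.isAcyclic.isPath_iff_isChain _).1 hp.reverse,
      (hT.isAcyclic.isPath_iff_isChain _).1 hq, ?_⟩
    simpa [SimpleGraph.Walk.edges_reverse] using ⟨fun h _ => ha.ne h.symm, hab⟩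
  obtain ⟨r, hr', hlen⟩ := hT.connected.exists_path_of_dist y z
  have := congrArg (fun w => w.1.length) ((hT.isAcyclic.subsingleton_path y z).elim ⟨r, hr'⟩ ⟨_, hr⟩)
  simpa [← hlen, SimpleGraph.Walk.length_append, SimpleGraph.Walk.length_reverse] using this

namespace GTree

variable {G : Type u} [Group G]

theorem smul_injective_s18 (X : GTree G) (γ : G) : Function.Injective (X.smul γ) := by
  intro x y h
  simpa [← X.smul_mul, X.smul_one] using congrArg (X.smul γ⁻¹) h

/-- The graph endomorphism given by the action of a group element. -/
def smulHom (X : GTree G) (γ : G) : X.graph →g X.graph where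
  toFun := X.smul γ
  map_rel' h := X.smul_adj γ h

/-- In a proper `G`-tree, some element of the stabilizer of `x` moves `y` to distance
`2 d(x, y)` from itself. -/
theorem Proper.exists_mem_stab_dist_eq {X : GTree G} (hX : X.Proper) (x y : X.V) :
    ∃ γ ∈ X.stab x, X.graph.dist y (X.smul γ y) = 2 * X.graph.dist x y := by
  obtain ⟨p, hp, hlen⟩ := X.isTree.connected.exists_path_of_dist x y
  cases p with
  | nil => exact ⟨1, one_mem _, by simp [X.smul_one]⟩
  | @cons _ a _ h p =>
    obtain ⟨γ, hγ, hγa⟩ := SetLike.exists_of_lt (hX ⟨(x, a), h⟩)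
    have hγx : X.smul γ x = x := hγ
    have hne : a ≠ X.smul γ a := fun h' => hγa ⟨hγ, h'.symm⟩
    have hmap : ∃ (h' : X.graph.Adj (X.smul γ x) (X.smul γ a))
        (q : X.graph.Walk (X.smul γ a) (X.smul γ y)), (q.cons h').IsPath ∧ q.length = p.length :=
      ⟨X.smul_adj γ h, p.map (X.smulHom γ), hp.map (f := X.smulHom γ) (X.smul_injective_s18 γ),
        p.length_map _⟩
    rw [hγx] at hmap
    obtain ⟨h', q, hq, hql⟩ := hmap
    refine ⟨γ, hγ, ?_⟩
    rw [X.isTree.dist_eq_of_isPath_cons h h' hne hp hq, ← hlen, SimpleGraph.Walk.length_cons,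
      SimpleGraph.Walk.length_cons, hql, two_mul]

end GTree

open GTree in
/-- Proposition 7.3: let `X` be a proper `G`-tree and `φ : V(X) → V(X)`.
If `φ` is `L`-equivariant then `d(x, φ x) < L/2` for every vertex `x`; in
particular, if `φ` is equivariant then `φ` is the identity. -/
theorem proper_coarsely_equivariant_near_id {G : Type u} [Group G]
    (X : GTree G) (hXp : X.Proper) (φ : X.V → X.V) :
    (∀ L : ℝ,
      (∀ (γ : G) (x : X.V),
        (X.graph.dist (φ (X.smul γ x)) (X.smul γ (φ x)) : ℝ) < L) →
      ∀ x : X.V, (X.graph.dist x (φ x) : ℝ) < L / 2) ∧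
    ((∀ (γ : G) (x : X.V), φ (X.smul γ x) = X.smul γ (φ x)) → φ = id) := by
  have main : ∀ L : ℝ,
      (∀ (γ : G) (x : X.V),
        (X.graph.dist (φ (X.smul γ x)) (X.smul γ (φ x)) : ℝ) < L) →
      ∀ x : X.V, (X.graph.dist x (φ x) : ℝ) < L / 2 := by
    intro L hL x
    obtain ⟨γ, hγ, hdist⟩ := hXp.exists_mem_stab_dist_eq x (φ x)
    have hγx : X.smul γ x = x := hγ
    have h := hL γ x
    rw [hγx, hdist] at h
    push_cast at h
    linarith
  refine ⟨main, fun hφ => funext fun x => ?_⟩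
  have h := main 1 (fun γ x => by simp [hφ γ x]) x
  have h0 : X.graph.dist x (φ x) = 0 := by
    have : (X.graph.dist x (φ x) : ℝ) < 1 := by linarith
    exact Nat.lt_one_iff.1 (by exact_mod_cast this)
  exact (X.isTree.connected.dist_eq_zero_iff.1 h0).symm
end
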